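/- Let λ > 1, μ > 0 and ν > 0 satisfy μϱ(λ) ≤ ν. Then every maximizer ω ∈ Σ_{μ,ν,λ} has compactly supported vorticity: there exists R > 0 such that ω = 0 almost everywhere on Π \ B_R(0), i.e. the support of ω is a compact subset of the closure of Π. -/

import Mathlib

open MeasureTheory Real Filter

noncomputable section

/-- The upper half plane `Π = {x ∈ ℝ² : x₂ > 0}`. -/
def UHP : Set (ℝ × ℝ) := {x | 0 < x.2}

/-- Euclidean norm of a point of `ℝ²`. -/
def rad (x : ℝ × ℝ) : ℝ := Real.sqrt (x.1 ^ 2 + x.2 ^ 2)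

/-- Modified Bessel function of the second kind of order `0`:
`K₀(r) = ∫₀^∞ exp(-r cosh t) dt`. -/
def K0 (r : ℝ) : ℝ := ∫ t in Set.Ioi (0 : ℝ), Real.exp (-(r * Real.cosh t))

/-- Fundamental solution `G(x,y) = (1/2π) K₀(|x-y|)` of `−Δ + Id` on `ℝ²`. -/
def Gker (x y : ℝ × ℝ) : ℝ := (1 / (2 * Real.pi)) * K0 (rad (x - y))

/-- Reflection `x̄ = (x₁, −x₂)` across the `x₁`-axis. -/
def reflPt (x : ℝ × ℝ) : ℝ × ℝ := (x.1, -x.2)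

/-- Green's function `G_Π(x,y) = G(x,y) − G(x̄,y)` of `−Δ + Id` on the half plane. -/
def GUHP (x y : ℝ × ℝ) : ℝ := Gker x y - Gker (reflPt x) y

/-- The operator `𝒢ω(x) = ∫_Π G_Π(x,y) ω(y) dy`. -/
def Gop (ω : ℝ × ℝ → ℝ) (x : ℝ × ℝ) : ℝ := ∫ y in UHP, GUHP x y * ω y

/-- Kinetic energy `E(ω) = (1/2) ∫_Π ω 𝒢ω`. -/
def kineticE (ω : ℝ × ℝ → ℝ) : ℝ := (1 / 2) * ∫ x in UHP, ω x * Gop ω x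

/-- Impulse `I(ω) = ∫_Π x₂ ω dx`. -/
def impulse (ω : ℝ × ℝ → ℝ) : ℝ := ∫ x in UHP, x.2 * ω x

/-- `L¹(Π)` norm. -/
def normL1 (f : ℝ × ℝ → ℝ) : ℝ := ∫ x in UHP, |f x|

/-- `L²(Π)` norm. -/
def normL2 (f : ℝ × ℝ → ℝ) : ℝ := (∫ x in UHP, (f x) ^ 2) ^ ((1 : ℝ) / 2)

/-- `L^s(Π)` norm. -/
def normLs (s : ℝ) (f : ℝ × ℝ → ℝ) : ℝ := (∫ x in UHP, |f x| ^ s) ^ (1 / s)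

/-- Nonnegative member of `L¹(Π) ∩ L²(Π)`. -/
def NonnegL1L2 (ω : ℝ × ℝ → ℝ) : Prop :=
  (∀ x ∈ UHP, 0 ≤ ω x) ∧ IntegrableOn ω UHP ∧ IntegrableOn (fun x => (ω x) ^ 2) UHP

/-- Steiner symmetry in the `x₁` variable. -/
def SteinerSym (f : ℝ × ℝ → ℝ) : Prop :=
  (∀ x : ℝ × ℝ, f (-x.1, x.2) = f x) ∧
  ∀ x₂ : ℝ, 0 < x₂ → AntitoneOn (fun x₁ => f (x₁, x₂)) (Set.Ioi (0 : ℝ))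

/-- The admissible class `𝒜_{μ,ν}`. -/
def InAdm (μ ν : ℝ) (ω : ℝ × ℝ → ℝ) : Prop :=
  (∀ x ∈ UHP, 0 ≤ ω x) ∧ IntegrableOn ω UHP ∧ IntegrableOn (fun x => (ω x) ^ 2) UHP ∧
  IntegrableOn (fun x => x.2 * ω x) UHP ∧
  impulse ω = μ ∧ (∫ x in UHP, ω x) ≤ ν

/-- The energy functional `ℰ_λ(ω) = E(ω) − (1/(2λ)) ∫_Π ω²`. -/
def Efun (lam : ℝ) (ω : ℝ × ℝ → ℝ) : ℝ :=
  kineticE ω - (1 / (2 * lam)) * ∫ x in UHP, (ω x) ^ 2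

/-- The supremum `S_{μ,ν,λ} = sup_{ω ∈ 𝒜_{μ,ν}} ℰ_λ(ω)`. -/
def Sval (lam μ ν : ℝ) : ℝ := sSup {s | ∃ ω, InAdm μ ν ω ∧ s = Efun lam ω}

/-- `ω` is a maximizer, i.e. `ω ∈ Σ_{μ,ν,λ}`. -/
def IsMaximizer (lam μ ν : ℝ) (ω : ℝ × ℝ → ℝ) : Prop :=
  InAdm μ ν ω ∧ Efun lam ω = Sval lam μ ν

/-- Bessel function of the first kind of order one. -/
def J1 (r : ℝ) : ℝ :=
  ∑' k : ℕ, ((-1 : ℝ) ^ k / ((Nat.factorial k : ℝ) * (Nat.factorial (k + 1) : ℝ))) *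
    (r / 2) ^ (2 * k + 1)

/-- Modified Bessel function of the second kind of order one. -/
def K1 (r : ℝ) : ℝ := ∫ t in Set.Ioi (0 : ℝ), Real.exp (-(r * Real.cosh t)) * Real.cosh t

/-- The set of `t > 0` with `J₁(√(λ−1) t) ≠ 0` solving the transcendental equation
`t (K₁'(t)/K₁(t) + (λ−1)^{-1/2} J₁'(√(λ−1)t)/J₁(√(λ−1)t)) = λ/(λ−1)`. -/
def aSet (lam : ℝ) : Set ℝ :=
  {t | 0 < t ∧ J1 (Real.sqrt (lam - 1) * t) ≠ 0 ∧
    t * (deriv K1 t / K1 t +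
      (1 / Real.sqrt (lam - 1)) *
        (deriv J1 (Real.sqrt (lam - 1) * t) / J1 (Real.sqrt (lam - 1) * t))) = lam / (lam - 1)}

/-- The smallest positive solution `a = a(λ)`. -/
def aLam (lam : ℝ) : ℝ := sInf (aSet lam)

/-- The stream function `Ψ_L^{λ,W}` of the Lamb dipole, written in polar coordinates
`x₁ = r cos θ`, `x₂ = r sin θ` (so that `sin θ = x₂ / r`). -/
def PsiL (lam W : ℝ) (x : ℝ × ℝ) : ℝ :=
  if rad x ≤ aLam lam then
    ((-(W * aLam lam / (lam - 1)) / J1 (Real.sqrt (lam - 1) * aLam lam)) *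
        J1 (Real.sqrt (lam - 1) * rad x) + (W * lam / (lam - 1)) * rad x) * (x.2 / rad x)
  else (W * aLam lam / K1 (aLam lam)) * K1 (rad x) * (x.2 / rad x)

/-- The Lamb dipole `ω_L^{λ,W} = λ (Ψ_L^{λ,W} − W x₂)₊` restricted to `Π`. -/
def omegaL (lam W : ℝ) (x : ℝ × ℝ) : ℝ :=
  if 0 < x.2 then lam * max (PsiL lam W x - W * x.2) 0 else 0

/-- `ϱ(λ) = (∫_Π ω_L^{λ,1} dx) / I(ω_L^{λ,1})`. -/
def varrho (lam : ℝ) : ℝ := (∫ x in UHP, omegaL lam 1 x) / impulse (omegaL lam 1)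

/-- The Laplacian on `ℝ²`, written coordinatewise. -/
def lap (ψ : ℝ × ℝ → ℝ) (x : ℝ × ℝ) : ℝ :=
  deriv (deriv fun t => ψ (t, x.2)) x.1 + deriv (deriv fun t => ψ (x.1, t)) x.2

/-- Distance (in `L¹ ∩ L²` plus weighted `L¹`) from `ζ` to a set of functions `S`. -/
def distToSet (S : Set ((ℝ × ℝ) → ℝ)) (ζ : (ℝ × ℝ) → ℝ) : ℝ :=
  sInf {d | ∃ ω ∈ S, d = normL1 (fun x => ζ x - ω x) + normL2 (fun x => ζ x - ω x) +
    normL1 (fun x => x.2 * (ζ x - ω x))}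

end


/-! ### Facts about `K0` -/

theorem cosh_lower (t : ℝ) : 1 + t ^ 2 / 2 ≤ Real.cosh t := by
  have h1 : Real.cosh t = 1 + 2 * Real.sinh (t / 2) ^ 2 := by
    have := Real.cosh_two_mul (t / 2)
    rw [show 2 * (t / 2) = t by ring] at this
    rw [this, Real.cosh_sq]; ring
  have h2 : (t / 2) ^ 2 ≤ Real.sinh (t / 2) ^ 2 := by
    rcases le_total 0 (t / 2) with h | h
    · have := Real.self_le_sinh_iff.2 h
      exact pow_le_pow_left₀ h this 2
    · have := Real.sinh_le_self_iff.2 h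
      nlinarith
  rw [h1]; nlinarith

theorem K0_integrand_le {r : ℝ} (hr : 0 < r) (t : ℝ) :
    Real.exp (-(r * Real.cosh t)) ≤ Real.exp (-r) * Real.exp (-(r / 2) * t ^ 2) := by
  rw [← Real.exp_add]
  apply Real.exp_le_exp.2
  have := mul_le_mul_of_nonneg_left (cosh_lower t) hr.le
  nlinarith

theorem K0_integrable {r : ℝ} (hr : 0 < r) :
    IntegrableOn (fun t => Real.exp (-(r * Real.cosh t))) (Set.Ioi (0 : ℝ)) := by
  have h := ((integrable_exp_neg_mul_sq (half_pos hr)).const_mul (Real.exp (-r))).integrableOn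
    (s := Set.Ioi (0 : ℝ))
  refine Integrable.mono' h ?_ ?_
  · exact (by fun_prop : Continuous fun t => Real.exp (-(r * Real.cosh t))).aestronglyMeasurable
  · refine Eventually.of_forall fun t => ?_
    rw [Real.norm_of_nonneg (Real.exp_pos _).le]
    exact K0_integrand_le hr t

theorem K0_nonneg (r : ℝ) : 0 ≤ K0 r := integral_nonneg fun _ => (Real.exp_pos _).le

theorem K0_le {r : ℝ} (hr : 0 < r) : K0 r ≤ 2 * (r ^ (-(1 / 2) : ℝ) * Real.exp (-r)) := by
  have h := ((integrable_exp_neg_mul_sq (half_pos hr)).const_mul (Real.exp (-r))).integrableOn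
    (s := Set.Ioi (0 : ℝ))
  have h1 : K0 r ≤ Real.exp (-r) * (√(π / (r / 2)) / 2) := by
    rw [← integral_gaussian_Ioi, ← integral_const_mul]
    exact integral_mono (K0_integrable hr) h fun t => K0_integrand_le hr t
  have h2 : √(π / (r / 2)) / 2 ≤ 2 * r ^ (-(1 / 2) : ℝ) := by
    rw [Real.rpow_neg hr.le, ← Real.sqrt_eq_rpow]
    have h4 : √(π / (r / 2)) ≤ √(16 / r) := by
      apply Real.sqrt_le_sqrt
      rw [div_le_div_iff₀ (half_pos hr) hr]
      nlinarith [Real.pi_le_four]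
    have h5 : √(16 / r) = 4 * (√r)⁻¹ := by
      rw [Real.sqrt_div (by norm_num), show (16 : ℝ) = 4 ^ 2 by norm_num,
        Real.sqrt_sq (by norm_num)]; rfl
    linarith
  calc K0 r ≤ _ := h1
    _ ≤ Real.exp (-r) * (2 * r ^ (-(1 / 2) : ℝ)) := by gcongr
    _ = _ := by ring

theorem K0_anti {r s : ℝ} (hr : 0 < r) (hrs : r ≤ s) : K0 s ≤ K0 r := by
  refine integral_mono (K0_integrable (hr.trans_le hrs)) (K0_integrable hr) fun t => ?_
  apply Real.exp_le_exp.2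
  have := Real.cosh_pos t
  nlinarith

theorem K0_sub_le {r s : ℝ} (hr : 0 < r) (hrs : r ≤ s) :
    K0 r - K0 s ≤ (s - r) * ((2 / r) * K0 (r / 2)) := by
  have e : (s - r) * ((2 / r) * K0 (r / 2)) =
      ∫ t in Set.Ioi (0 : ℝ), ((s - r) * (2 / r)) * Real.exp (-(r / 2 * Real.cosh t)) := by
    rw [integral_const_mul]; simp only [K0]; ring
  rw [e]
  unfold K0
  rw [← integral_sub (K0_integrable hr) (K0_integrable (hr.trans_le hrs))]
  refine integral_mono ((K0_integrable hr).sub (K0_integrable (hr.trans_le hrs)))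
    ((K0_integrable (half_pos hr)).const_mul _) fun t => ?_
  have hc := Real.cosh_pos t
  set c := Real.cosh t
  show Real.exp (-(r * c)) - Real.exp (-(s * c)) ≤ (s - r) * (2 / r) * Real.exp (-(r / 2 * c))
  have h1 : Real.exp (-(s * c)) = Real.exp (-(r * c)) * Real.exp (-((s - r) * c)) := by
    rw [← Real.exp_add]; ring_nf
  have h2 := Real.add_one_le_exp (-((s - r) * c))
  have h3 : Real.exp (-(r * c)) - Real.exp (-(s * c)) ≤ (s - r) * c * Real.exp (-(r * c)) := by
    rw [h1]; nlinarith [Real.exp_pos (-(r * c))]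
  have h4 : Real.exp (-(r * c)) = Real.exp (-(r / 2 * c)) * Real.exp (-(r / 2 * c)) := by
    rw [← Real.exp_add]; ring_nf
  have h5 : (r / 2 * c) * Real.exp (-(r / 2 * c)) ≤ 1 := by
    have := Real.add_one_le_exp (r / 2 * c)
    rw [Real.exp_neg, ← div_eq_mul_inv, div_le_one (Real.exp_pos _)]; linarith
  have h6 : c * Real.exp (-(r / 2 * c)) ≤ 2 / r := by
    rw [le_div_iff₀ hr]; nlinarith
  calc _ ≤ _ := h3
    _ = (s - r) * (c * Real.exp (-(r / 2 * c))) * Real.exp (-(r / 2 * c)) := by rw [h4]; ring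
    _ ≤ _ := by
      have : 0 ≤ s - r := by linarith
      gcongr

theorem K0_meas : Measurable K0 := by
  have : StronglyMeasurable (Function.uncurry fun (r t : ℝ) => Real.exp (-(r * Real.cosh t))) := by
    apply Continuous.stronglyMeasurable
    simp only [Function.uncurry_def]
    fun_prop
  exact (this.integral_prod_right (ν := volume.restrict (Set.Ioi (0 : ℝ)))).measurable

/-! ### `rad` -/
theorem rad_nonneg (z : ℝ × ℝ) : 0 ≤ rad z := Real.sqrt_nonneg _

theorem rad_cont : Continuous rad := by unfold rad; fun_prop

theorem norm_le_rad (z : ℝ × ℝ) : ‖z‖ ≤ rad z := by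
  rw [Prod.norm_def]
  apply max_le
  · rw [Real.norm_eq_abs]; exact Real.abs_le_sqrt (by nlinarith [sq_nonneg z.2])
  · rw [Real.norm_eq_abs]; exact Real.abs_le_sqrt (by nlinarith [sq_nonneg z.1])

theorem rad_pos {z : ℝ × ℝ} (hz : z ≠ 0) : 0 < rad z :=
  (norm_pos_iff.2 hz).trans_le (norm_le_rad z)

theorem rad_neg (z : ℝ × ℝ) : rad (-z) = rad z := by simp [rad]

theorem rad_le_add (z : ℝ × ℝ) (c : ℝ) (hc : 0 ≤ c) : rad (z.1, z.2 - c) ≤ rad z + c := by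
  have h : rad (z.1, z.2 - c) ^ 2 = z.1 ^ 2 + (z.2 - c) ^ 2 := Real.sq_sqrt (by positivity)
  have h2 : rad z ^ 2 = z.1 ^ 2 + z.2 ^ 2 := Real.sq_sqrt (by positivity)
  have h3 : |z.2| ≤ rad z := by
    exact Real.abs_le_sqrt (by nlinarith [sq_nonneg z.1])
  have h4 := rad_nonneg z
  have h5 := neg_abs_le z.2
  apply abs_le_of_sq_le_sq' _ (by positivity) |>.2
  nlinarith

theorem ae_ne (x : ℝ × ℝ) : ∀ᵐ y : ℝ × ℝ, y ≠ x :=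
  compl_mem_ae_iff.2 (measure_singleton x)

theorem integrable_norm_rpow_exp {s b : ℝ} (hs : -2 < s) (hb : 0 < b) :
    Integrable (fun z : ℝ × ℝ => ‖z‖ ^ s * Real.exp (-b * ‖z‖)) := by
  have := integrable_fun_norm_addHaar (volume : Measure (ℝ × ℝ))
    (f := fun r : ℝ => r ^ s * Real.exp (-b * r))
  refine this.2 ?_
  have h2 := integrableOn_rpow_mul_exp_neg_mul_rpow (p := 1) (s := s + 1) (b := b)
    (by linarith) one_pos hb
  refine h2.congr_fun (fun r hr => ?_) measurableSet_Ioi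
  have hr' : (0 : ℝ) < r := hr
  simp only [Module.finrank_prod, Module.finrank_self, Real.rpow_one, smul_eq_mul]
  rw [Real.rpow_add hr', Real.rpow_one]
  norm_num
  ring

/-! ### The kernel on the plane -/
noncomputable def PhiK (z : ℝ × ℝ) : ℝ := (1 / (2 * Real.pi)) * K0 (rad z)

noncomputable def HK (z : ℝ × ℝ) : ℝ := (2 / rad z) * K0 (rad z / 2)

theorem PhiK_nonneg (z : ℝ × ℝ) : 0 ≤ PhiK z :=
  mul_nonneg (by positivity) (K0_nonneg _)

theorem HK_nonneg (z : ℝ × ℝ) : 0 ≤ HK z :=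
  mul_nonneg (div_nonneg (by norm_num) (rad_nonneg z)) (K0_nonneg _)

theorem PhiK_meas : Measurable PhiK :=
  (K0_meas.comp rad_cont.measurable).const_mul _

theorem HK_meas : Measurable HK :=
  (measurable_const.div rad_cont.measurable).mul
    (K0_meas.comp (rad_cont.measurable.div_const 2))

theorem PhiK_neg (z : ℝ × ℝ) : PhiK (-z) = PhiK z := by simp [PhiK, rad_neg]

theorem PhiK_le {z : ℝ × ℝ} (hz : z ≠ 0) :
    PhiK z ≤ ‖z‖ ^ (-(1 / 2) : ℝ) * Real.exp (-1 * ‖z‖) := by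
  have hn := norm_pos_iff.2 hz
  have h1 : K0 (rad z) ≤ _ := (K0_anti hn (norm_le_rad z)).trans (K0_le hn)
  have hp : 1 / (2 * Real.pi) ≤ 1 / 2 := by
    apply one_div_le_one_div_of_le (by norm_num); nlinarith [Real.pi_gt_three]
  calc PhiK z ≤ (1 / 2) * (2 * (‖z‖ ^ (-(1 / 2) : ℝ) * Real.exp (-‖z‖))) := by
        unfold PhiK
        exact mul_le_mul hp h1 (K0_nonneg _) (by norm_num)
    _ = _ := by rw [neg_one_mul]; ring

theorem PhiK_integrable : Integrable PhiK := by
  refine Integrable.mono' (integrable_norm_rpow_exp (s := -(1 / 2)) (b := 1) (by norm_num) one_pos)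
    PhiK_meas.aestronglyMeasurable ?_
  filter_upwards [ae_ne 0] with z hz
  rw [Real.norm_of_nonneg (PhiK_nonneg z)]
  exact PhiK_le hz

theorem PhiK_sq_integrable : Integrable (fun z => PhiK z ^ 2) := by
  refine Integrable.mono' (integrable_norm_rpow_exp (s := -1) (b := 2) (by norm_num) two_pos)
    (PhiK_meas.pow_const 2).aestronglyMeasurable ?_
  filter_upwards [ae_ne 0] with z hz
  rw [Real.norm_of_nonneg (by positivity)]
  have hn := norm_pos_iff.2 hz
  calc PhiK z ^ 2 ≤ (‖z‖ ^ (-(1 / 2) : ℝ) * Real.exp (-1 * ‖z‖)) ^ 2 :=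
        pow_le_pow_left₀ (PhiK_nonneg z) (PhiK_le hz) 2
    _ = _ := by
      rw [mul_pow, ← Real.rpow_natCast, ← Real.rpow_mul hn.le, ← Real.exp_nat_mul]
      norm_num

theorem HK_integrable : Integrable HK := by
  refine Integrable.mono' ((integrable_norm_rpow_exp (s := -(3 / 2)) (b := 1 / 2)
    (by norm_num) (by norm_num)).const_mul (4 * (1 / 2 : ℝ) ^ (-(1 / 2) : ℝ)))
    HK_meas.aestronglyMeasurable ?_
  filter_upwards [ae_ne 0] with z hz
  rw [Real.norm_of_nonneg (HK_nonneg z)]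
  have hn := norm_pos_iff.2 hz
  have hr := norm_le_rad z
  have h1 : K0 (rad z / 2) ≤ _ := (K0_anti (half_pos hn) (by linarith)).trans (K0_le (half_pos hn))
  have h2 : 2 / rad z ≤ 2 / ‖z‖ := by gcongr
  calc HK z ≤ (2 / ‖z‖) * (2 * ((‖z‖ / 2) ^ (-(1 / 2) : ℝ) * Real.exp (-(‖z‖ / 2)))) :=
        mul_le_mul h2 h1 (K0_nonneg _) (by positivity)
    _ = _ := by
      rw [show ‖z‖ / 2 = (1 / 2) * ‖z‖ by ring, Real.mul_rpow (by norm_num) hn.le,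
        show (-(3 / 2) : ℝ) = -(1 / 2) - 1 by norm_num, Real.rpow_sub_one hn.ne']
      rw [neg_mul]
      ring

theorem PhiK_tendsto : Tendsto PhiK (cocompact (ℝ × ℝ)) (nhds 0) := by
  have h1 : Tendsto (fun z : ℝ × ℝ => ‖z‖ ^ (-(1 / 2) : ℝ)) (cocompact (ℝ × ℝ)) (nhds 0) :=
    (tendsto_rpow_neg_atTop (by norm_num : (0 : ℝ) < 1 / 2)).comp (tendsto_norm_cocompact_atTop)
  refine squeeze_zero' (Eventually.of_forall PhiK_nonneg) ?_ h1
  have : ∀ᶠ z in cocompact (ℝ × ℝ), 0 < ‖z‖ :=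
    tendsto_norm_cocompact_atTop.eventually (eventually_gt_atTop 0)
  filter_upwards [this] with z hz
  refine (PhiK_le (norm_pos_iff.1 hz)).trans ?_
  have : Real.exp (-1 * ‖z‖) ≤ 1 := Real.exp_le_one_iff.2 (by linarith)
  exact mul_le_of_le_one_right (by positivity) this


/-! ### The total mass of the kernel -/

theorem hasDerivAt_sinh_div_cosh (t : ℝ) :
    HasDerivAt (fun t => Real.sinh t / Real.cosh t) (1 / Real.cosh t ^ 2) t := by
  have h := (Real.hasDerivAt_sinh t).div (Real.hasDerivAt_cosh t) (Real.cosh_pos t).ne'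
  have := Real.cosh_sq t
  rw [show Real.cosh t * Real.cosh t - Real.sinh t * Real.sinh t = 1 by nlinarith] at h
  exact h

theorem tendsto_sinh_div_cosh :
    Tendsto (fun t => Real.sinh t / Real.cosh t) atTop (nhds 1) := by
  have h1 : Tendsto (fun t : ℝ => Real.exp (-2 * t)) atTop (nhds 0) := by
    apply Real.tendsto_exp_atBot.comp
    exact tendsto_id.const_mul_atTop_of_neg (by norm_num)
  have h2 : Tendsto (fun t : ℝ => (1 - Real.exp (-2 * t)) / (1 + Real.exp (-2 * t))) atTop
      (nhds ((1 - 0) / (1 + 0))) :=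
    (tendsto_const_nhds.sub h1).div (tendsto_const_nhds.add h1) (by norm_num)
  simp only [sub_zero, add_zero, div_one] at h2
  refine h2.congr fun t => ?_
  rw [Real.sinh_eq, Real.cosh_eq]
  have h3 : Real.exp (-t) = Real.exp t * Real.exp (-2 * t) := by rw [← Real.exp_add]; ring_nf
  rw [h3]
  have := Real.exp_pos t
  have := Real.exp_pos (-2 * t)
  field_simp

theorem integrable_inv_cosh_sq :
    IntegrableOn (fun t => 1 / Real.cosh t ^ 2) (Set.Ioi (0 : ℝ)) :=
  integrableOn_Ioi_deriv_of_nonneg' (fun t _ => hasDerivAt_sinh_div_cosh t)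
    (fun t _ => by positivity) tendsto_sinh_div_cosh

theorem integral_inv_cosh_sq : ∫ t in Set.Ioi (0 : ℝ), 1 / Real.cosh t ^ 2 = 1 := by
  rw [integral_Ioi_of_hasDerivAt_of_tendsto' (fun t _ => hasDerivAt_sinh_div_cosh t)
    integrable_inv_cosh_sq tendsto_sinh_div_cosh]
  simp

theorem integral_r_exp {c : ℝ} (hc : 0 < c) :
    ∫ r in Set.Ioi (0 : ℝ), r * Real.exp (-(r * c)) = 1 / c ^ 2 := by
  have := Real.integral_rpow_mul_exp_neg_mul_Ioi (a := 2) (r := c) two_pos hc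
  have h2 : Real.Gamma 2 = 1 := by simp
  rw [h2] at this
  norm_num at this
  rw [← inv_eq_one_div, ← this]
  congr 1
  ext r
  rw [mul_comm r c]

theorem integrable_r_exp {c : ℝ} (hc : 0 < c) :
    IntegrableOn (fun r => r * Real.exp (-(r * c))) (Set.Ioi (0 : ℝ)) := by
  have h2 := integrableOn_rpow_mul_exp_neg_mul_rpow (p := 1) (s := 1) (b := c)
    (by norm_num) one_pos hc
  refine h2.congr_fun (fun r hr => ?_) measurableSet_Ioi
  simp [mul_comm]

theorem integral_r_K0 : ∫ r in Set.Ioi (0 : ℝ), r * K0 r = 1 := by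
  have e : ∀ r : ℝ, r * K0 r =
      ∫ t in Set.Ioi (0 : ℝ), r * Real.exp (-(r * Real.cosh t)) := fun r => by
    rw [integral_const_mul]; rfl
  simp_rw [e]
  rw [integral_integral_swap]
  · simp_rw [fun t => integral_r_exp (Real.cosh_pos t)]
    exact integral_inv_cosh_sq
  · rw [integrable_prod_iff']
    · refine ⟨Eventually.of_forall fun t => integrable_r_exp (Real.cosh_pos t), ?_⟩
      refine integrable_inv_cosh_sq.congr (Eventually.of_forall fun t => ?_)
      simp only [Function.uncurry]
      rw [← integral_r_exp (Real.cosh_pos t)]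
      refine setIntegral_congr_fun measurableSet_Ioi fun r hr => ?_
      have hr' : (0 : ℝ) < r := hr
      show _ = ‖_‖
      rw [Real.norm_of_nonneg (by positivity)]
    · apply Continuous.aestronglyMeasurable
      simp only [Function.uncurry_def]
      fun_prop

theorem integral_PhiK : ∫ z, PhiK z = 1 := by
  rw [← integral_comp_polarCoord_symm]
  have h1 : ∀ p ∈ polarCoord.target, p.1 • PhiK (polarCoord.symm p) =
      (p.1 * K0 p.1) * (1 / (2 * π)) := by
    intro p hp
    have hp1 : 0 < p.1 := by
      rw [polarCoord_target] at hp; exact hp.1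
    have : rad (polarCoord.symm p) = p.1 := by
      rw [polarCoord_symm_apply, rad]
      rw [show (p.1 * Real.cos p.2) ^ 2 + (p.1 * Real.sin p.2) ^ 2 =
        p.1 ^ 2 * (Real.sin p.2 ^ 2 + Real.cos p.2 ^ 2) by ring, Real.sin_sq_add_cos_sq, mul_one,
        Real.sqrt_sq hp1.le]
    rw [PhiK, this, smul_eq_mul]; ring
  rw [setIntegral_congr_fun polarCoord.open_target.measurableSet h1, polarCoord_target,
    Measure.volume_eq_prod,
    setIntegral_prod_mul (fun r => r * K0 r) (fun _ => 1 / (2 * π)), integral_r_K0]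
  rw [setIntegral_const]
  have : volume.real (Set.Ioo (-π) π) = 2 * π := by
    rw [measureReal_def, Real.volume_Ioo, ENNReal.toReal_ofReal (by linarith [Real.pi_pos])]
    ring
  rw [this, smul_eq_mul]
  have := Real.pi_pos
  field_simp


/-! ### The half-plane kernel -/

theorem UHP_meas : MeasurableSet UHP := measurableSet_lt measurable_const measurable_snd

theorem reflPt_meas : Measurable reflPt := by unfold reflPt; fun_prop

theorem GUHP_eq (x y : ℝ × ℝ) : GUHP x y = PhiK (x - y) - PhiK (reflPt x - y) := rfl

theorem GUHP_meas : Measurable (fun p : (ℝ × ℝ) × (ℝ × ℝ) => GUHP p.1 p.2) := by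
  simp only [GUHP_eq]
  exact (PhiK_meas.comp (measurable_fst.sub measurable_snd)).sub
    (PhiK_meas.comp ((reflPt_meas.comp measurable_fst).sub measurable_snd))

theorem GUHP_symm (x y : ℝ × ℝ) : GUHP x y = GUHP y x := by
  have h1 : rad (x - y) = rad (y - x) := by rw [← rad_neg, neg_sub]
  have h2 : rad (reflPt x - y) = rad (reflPt y - x) := by
    simp only [rad, reflPt, Prod.fst_sub, Prod.snd_sub]; congr 1; ring
  simp only [GUHP, Gker, h1, h2]

theorem rad_refl_ge {x y : ℝ × ℝ} (hx : x ∈ UHP) (hy : y ∈ UHP) :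
    rad (x - y) ≤ rad (reflPt x - y) := by
  have hx' : 0 < x.2 := hx
  have hy' : 0 < y.2 := hy
  apply Real.sqrt_le_sqrt
  simp only [reflPt, Prod.fst_sub, Prod.snd_sub]
  nlinarith [mul_pos hx' hy']

theorem rad_refl_le {x y : ℝ × ℝ} (hx : x ∈ UHP) :
    rad (reflPt x - y) ≤ rad (x - y) + 2 * x.2 := by
  have hx' : 0 < x.2 := hx
  have := rad_le_add (x - y) (2 * x.2) (by positivity)
  convert this using 2
  simp only [reflPt]
  ext
  · simp
  · simp; ring

theorem GUHP_nonneg {x y : ℝ × ℝ} (hx : x ∈ UHP) (hy : y ∈ UHP) (hxy : y ≠ x) :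
    0 ≤ GUHP x y := by
  have h := rad_pos (sub_ne_zero.2 hxy.symm)
  have := K0_anti h (rad_refl_ge hx hy)
  rw [GUHP_eq, PhiK, PhiK, ← mul_sub]
  exact mul_nonneg (by positivity) (sub_nonneg.2 this)

theorem GUHP_le (x y : ℝ × ℝ) : GUHP x y ≤ PhiK (x - y) := by
  rw [GUHP_eq]; linarith [PhiK_nonneg (reflPt x - y)]

theorem GUHP_le_HK {x y : ℝ × ℝ} (hx : x ∈ UHP) (hy : y ∈ UHP) (hxy : y ≠ x) :
    GUHP x y ≤ x.2 * HK (x - y) := by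
  have hx' : 0 < x.2 := hx
  have h := rad_pos (sub_ne_zero.2 hxy.symm)
  have h1 := K0_sub_le h (rad_refl_ge hx hy)
  have h2 := rad_refl_le (y := y) hx
  have h3 : K0 (rad (x - y)) - K0 (rad (reflPt x - y)) ≤ (2 * x.2) * HK (x - y) :=
    h1.trans (mul_le_mul_of_nonneg_right (by linarith) (HK_nonneg _))
  have hp : 1 / (2 * Real.pi) ≤ 1 / 2 := by
    apply one_div_le_one_div_of_le (by norm_num); nlinarith [Real.pi_gt_three]
  rw [GUHP_eq, PhiK, PhiK, ← mul_sub]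
  calc _ ≤ (1 / (2 * Real.pi)) * ((2 * x.2) * HK (x - y)) := by gcongr
    _ ≤ (1 / 2) * ((2 * x.2) * HK (x - y)) := by
        have := HK_nonneg (x - y)
        gcongr
    _ = _ := by ring

/-- The linear space `L¹ ∩ L²`. -/
def VV (f : ℝ × ℝ → ℝ) : Prop := IntegrableOn f UHP ∧ IntegrableOn (fun x => (f x) ^ 2) UHP

theorem VV.mul {f g : ℝ × ℝ → ℝ} (hf : VV f) (hg : VV g) :
    IntegrableOn (fun x => f x * g x) UHP := by
  refine Integrable.mono' (hf.2.add hg.2)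
    (hf.1.aestronglyMeasurable.mul hg.1.aestronglyMeasurable) (Eventually.of_forall fun x => ?_)
  simp only [Pi.add_apply, Real.norm_eq_abs]
  rw [abs_le]
  constructor <;> nlinarith [sq_nonneg (f x + g x), sq_nonneg (f x - g x), sq_nonneg (f x),
    sq_nonneg (g x)]

theorem VV.const_mul {f : ℝ × ℝ → ℝ} (hf : VV f) (c : ℝ) : VV (fun x => c * f x) := by
  refine ⟨hf.1.const_mul c, ?_⟩
  refine (hf.2.const_mul (c ^ 2)).congr (Eventually.of_forall fun x => ?_)
  simp only [mul_pow]

theorem VV.add {f g : ℝ × ℝ → ℝ} (hf : VV f) (hg : VV g) : VV (fun x => f x + g x) := by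
  refine ⟨hf.1.add hg.1, ?_⟩
  have := (hf.2.add ((hf.mul hg).const_mul 2)).add hg.2
  refine this.congr (Eventually.of_forall fun x => ?_)
  simp only [Pi.add_apply]; ring

theorem VV.indicator {f : ℝ × ℝ → ℝ} (hf : VV f) {A : Set (ℝ × ℝ)} (hA : MeasurableSet A) :
    VV (A.indicator f) := by
  refine ⟨hf.1.indicator hA, ?_⟩
  refine (hf.2.indicator hA).congr (Eventually.of_forall fun x => ?_)
  by_cases h : x ∈ A <;> simp [h]

theorem slice_integrable {g : ℝ × ℝ → ℝ} (hg : VV g) (x : ℝ × ℝ) :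
    IntegrableOn (fun y => GUHP x y * g y) UHP := by
  have h1 : ∀ x : ℝ × ℝ, IntegrableOn (fun y => PhiK (x - y) ^ 2) UHP := fun x =>
    (PhiK_sq_integrable.comp_sub_left x).integrableOn
  refine Integrable.mono' (((h1 x).add (h1 (reflPt x))).add hg.2) ?_
    (Eventually.of_forall fun y => ?_)
  · exact (GUHP_meas.comp (measurable_const.prodMk measurable_id)).aestronglyMeasurable.mul
      hg.1.aestronglyMeasurable
  · simp only [Pi.add_apply, Real.norm_eq_abs, GUHP_eq]
    rw [abs_le]
    set a := PhiK (x - y)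
    set b := PhiK (reflPt x - y)
    constructor <;> nlinarith [sq_nonneg (a + g y / 2), sq_nonneg (a - g y / 2),
      sq_nonneg (b - g y / 2), sq_nonneg (b + g y / 2), sq_nonneg (g y)]

/-- `∫ Φ²`. -/
noncomputable def C2 : ℝ := ∫ z, PhiK z ^ 2

theorem C2_nonneg : 0 ≤ C2 := integral_nonneg fun z => sq_nonneg _

theorem ae_good (x : ℝ × ℝ) : ∀ᵐ y ∂(volume.restrict UHP), y ∈ UHP ∧ y ≠ x := by
  filter_upwards [ae_restrict_mem UHP_meas, ae_restrict_of_ae (ae_ne x)] with y h1 h2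
  exact ⟨h1, h2⟩

theorem slice_bound {g : ℝ × ℝ → ℝ} (hg : VV g) {x : ℝ × ℝ} (hx : x ∈ UHP) {ε : ℝ} (hε : 0 < ε) :
    ∫ y in UHP, ‖GUHP x y * g y‖ ≤ C2 / (4 * ε) + ε * ∫ y in UHP, (g y) ^ 2 := by
  have h1 : IntegrableOn (fun y => PhiK (x - y) ^ 2) UHP :=
    (PhiK_sq_integrable.comp_sub_left x).integrableOn
  have h2 : ∫ y in UHP, PhiK (x - y) ^ 2 ≤ C2 := by
    have : ∫ y, PhiK (x - y) ^ 2 = C2 := integral_sub_left_eq_self (fun z => PhiK z ^ 2) volume x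
    rw [← this]
    exact setIntegral_le_integral (PhiK_sq_integrable.comp_sub_left x)
      (Eventually.of_forall fun y => sq_nonneg _)
  calc ∫ y in UHP, ‖GUHP x y * g y‖
      ≤ ∫ y in UHP, ((1 / (4 * ε)) * PhiK (x - y) ^ 2 + ε * (g y) ^ 2) := by
        refine integral_mono_ae (slice_integrable hg x).norm
          ((h1.const_mul _).add (hg.2.const_mul _)) ?_
        filter_upwards [ae_good x] with y hy
        have k1 := GUHP_nonneg hx hy.1 hy.2
        have k2 := GUHP_le x y
        rw [norm_mul, Real.norm_of_nonneg k1, Real.norm_eq_abs]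
        refine (mul_le_mul_of_nonneg_right k2 (abs_nonneg _)).trans ?_
        rw [← sq_abs (g y)]
        set a := PhiK (x - y)
        set b := |g y|
        have : (1 / (4 * ε)) * a ^ 2 + ε * b ^ 2 - a * b = (1 / (4 * ε)) * (a - 2 * ε * b) ^ 2 := by
          field_simp; ring
        have h3 : 0 ≤ (1 / (4 * ε)) * (a - 2 * ε * b) ^ 2 := by positivity
        linarith
    _ = (1 / (4 * ε)) * (∫ y in UHP, PhiK (x - y) ^ 2) + ε * ∫ y in UHP, (g y) ^ 2 := by
        rw [integral_add (h1.const_mul _) (hg.2.const_mul _), integral_const_mul,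
          integral_const_mul]
    _ ≤ (1 / (4 * ε)) * C2 + ε * ∫ y in UHP, (g y) ^ 2 := by gcongr
    _ = _ := by ring

theorem Gop_abs_le {g : ℝ × ℝ → ℝ} (hg : VV g) {x : ℝ × ℝ} (hx : x ∈ UHP) {ε : ℝ} (hε : 0 < ε) :
    |Gop g x| ≤ C2 / (4 * ε) + ε * ∫ y in UHP, (g y) ^ 2 :=
  (norm_integral_le_integral_norm _).trans (slice_bound hg hx hε)

theorem Gop_nonneg {g : ℝ × ℝ → ℝ} (hg : ∀ x ∈ UHP, 0 ≤ g x) {x : ℝ × ℝ} (hx : x ∈ UHP) :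
    0 ≤ Gop g x := by
  apply integral_nonneg_of_ae
  filter_upwards [ae_good x] with y hy
  exact mul_nonneg (GUHP_nonneg hx hy.1 hy.2) (hg y hy.1)

theorem prod_integrable {f g : ℝ × ℝ → ℝ} (hf : VV f) (hg : VV g) :
    Integrable (fun p : (ℝ × ℝ) × (ℝ × ℝ) => f p.1 * (GUHP p.1 p.2 * g p.2))
      ((volume.restrict UHP).prod (volume.restrict UHP)) := by
  have hm : AEStronglyMeasurable
      (fun p : (ℝ × ℝ) × (ℝ × ℝ) => f p.1 * (GUHP p.1 p.2 * g p.2))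
      ((volume.restrict UHP).prod (volume.restrict UHP)) :=
    hf.1.aestronglyMeasurable.comp_fst.mul
      (GUHP_meas.aestronglyMeasurable.mul hg.1.aestronglyMeasurable.comp_snd)
  rw [integrable_prod_iff hm]
  refine ⟨Eventually.of_forall fun x => ?_, ?_⟩
  · exact (slice_integrable hg x).const_mul (f x)
  refine Integrable.mono'
    (hf.1.norm.mul_const (C2 / (4 * 1) + 1 * ∫ y in UHP, (g y) ^ 2))
    hm.norm.integral_prod_right' ?_
  filter_upwards [ae_restrict_mem UHP_meas] with x hx
  rw [Real.norm_of_nonneg (integral_nonneg fun _ => norm_nonneg _)]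
  simp only [norm_mul (f x)]
  rw [integral_const_mul]
  exact mul_le_mul_of_nonneg_left (slice_bound hg hx one_pos) (norm_nonneg _)

theorem mul_Gop_integrable {f g : ℝ × ℝ → ℝ} (hf : VV f) (hg : VV g) :
    IntegrableOn (fun x => f x * Gop g x) UHP := by
  have := (prod_integrable hf hg).integral_prod_left
  refine this.congr (Eventually.of_forall fun x => ?_)
  simp only [integral_const_mul]; rfl

/-- The bilinear form. -/
noncomputable def BB (f g : ℝ × ℝ → ℝ) : ℝ := ∫ x in UHP, f x * Gop g x

theorem BB_symm {f g : ℝ × ℝ → ℝ} (hf : VV f) (hg : VV g) : BB f g = BB g f := by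
  have h1 : BB f g = ∫ x in UHP, ∫ y in UHP, f x * (GUHP x y * g y) := by
    unfold BB Gop; simp only [integral_const_mul]
  have h2 : BB g f = ∫ y in UHP, ∫ x in UHP, g y * (GUHP y x * f x) := by
    unfold BB Gop; simp only [integral_const_mul]
  rw [h1, h2, integral_integral_swap (prod_integrable hf hg)]
  congr 1; ext y; congr 1; ext x
  rw [GUHP_symm]; ring

theorem Gop_add_mul {f g : ℝ × ℝ → ℝ} (hf : VV f) (hg : VV g) (t : ℝ) (x : ℝ × ℝ) :
    Gop (fun x => f x + t * g x) x = Gop f x + t * Gop g x := by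
  unfold Gop
  rw [← integral_const_mul, ← integral_add (slice_integrable hf x)
    ((slice_integrable hg x).const_mul t)]
  congr 1; ext y; ring

/-- The first variation of the energy at `f` in direction `g`. -/
noncomputable def NN (lam : ℝ) (g f : ℝ × ℝ → ℝ) : ℝ :=
  BB g f - (1 / lam) * ∫ x in UHP, g x * f x

theorem int_lin3 {m : Measure (ℝ × ℝ)} {a b c : ℝ × ℝ → ℝ} (ha : Integrable a m)
    (hb : Integrable b m) (hc : Integrable c m) (s t : ℝ) :
    ∫ x, (a x + s * b x + t * c x) ∂m = (∫ x, a x ∂m) + s * (∫ x, b x ∂m) + t * ∫ x, c x ∂m := by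
  have h1 : Integrable (fun x => a x + s * b x) m := ha.add (hb.const_mul s)
  rw [integral_add h1 (hc.const_mul t), integral_add ha (hb.const_mul s), integral_const_mul,
    integral_const_mul]

theorem int_lin4 {m : Measure (ℝ × ℝ)} {a b c d : ℝ × ℝ → ℝ} (ha : Integrable a m)
    (hb : Integrable b m) (hc : Integrable c m) (hd : Integrable d m) (s t u : ℝ) :
    ∫ x, (a x + s * b x + t * c x + u * d x) ∂m =
      (∫ x, a x ∂m) + s * (∫ x, b x ∂m) + t * (∫ x, c x ∂m) + u * ∫ x, d x ∂m := by
  have h1 : Integrable (fun x => a x + s * b x + t * c x) m :=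
    (ha.add (hb.const_mul s)).add (hc.const_mul t)
  rw [integral_add h1 (hd.const_mul u), int_lin3 ha hb hc, integral_const_mul]

theorem Efun_add_mul {lam : ℝ} {f g : ℝ × ℝ → ℝ} (hf : VV f) (hg : VV g) (t : ℝ) :
    Efun lam (fun x => f x + t * g x) = Efun lam f + t * NN lam g f + t ^ 2 * Efun lam g := by
  have hff := mul_Gop_integrable hf hf
  have hfg := mul_Gop_integrable hf hg
  have hgf := mul_Gop_integrable hg hf
  have hgg := mul_Gop_integrable hg hg
  have e1 : ∫ x in UHP, (f x + t * g x) * Gop (fun x => f x + t * g x) x =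
      BB f f + t * BB f g + t * BB g f + t ^ 2 * BB g g := by
    unfold BB
    rw [← int_lin4 hff hfg hgf hgg]
    congr 1; ext x
    simp only [Gop_add_mul hf hg]; ring
  have e2 : ∫ x in UHP, (f x + t * g x) ^ 2 = (∫ x in UHP, (f x) ^ 2) +
      2 * t * (∫ x in UHP, g x * f x) + t ^ 2 * ∫ x in UHP, (g x) ^ 2 := by
    have hm := hg.mul hf
    rw [← int_lin3 hf.2 hm hg.2]
    congr 1; ext x
    ring
  have e3 := BB_symm hf hg
  unfold Efun kineticE NN
  rw [e1, e2, e3]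
  have e4 : ∀ g : ℝ × ℝ → ℝ, ∫ x in UHP, g x * Gop g x = BB g g := fun _ => rfl
  simp only [e4]
  rw [show (1 / (2 * lam) : ℝ) = 1 / lam / 2 by rw [div_div, mul_comm]]
  ring

theorem NN_add_mul {lam : ℝ} {f g w : ℝ × ℝ → ℝ} (hf : VV f) (hg : VV g) (hw : VV w) (t : ℝ) :
    NN lam (fun x => f x + t * g x) w = NN lam f w + t * NN lam g w := by
  have h1 : BB (fun x => f x + t * g x) w = BB f w + t * BB g w := by
    unfold BB
    rw [← integral_const_mul, ← integral_add (mul_Gop_integrable hf hw)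
      ((mul_Gop_integrable hg hw).const_mul t)]
    congr 1; ext x; ring
  have h2 : ∫ x in UHP, (f x + t * g x) * w x =
      (∫ x in UHP, f x * w x) + t * ∫ x in UHP, g x * w x := by
    rw [← integral_const_mul, ← integral_add (hf.mul hw) ((hg.mul hw).const_mul t)]
    congr 1; ext x; ring
  unfold NN
  rw [h1, h2]; ring

theorem NN_self {lam : ℝ} (f : ℝ × ℝ → ℝ) : NN lam f f = 2 * Efun lam f := by
  unfold NN Efun kineticE BB
  rw [show (1 / (2 * lam) : ℝ) = 1 / lam / 2 by rw [div_div, mul_comm]]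
  simp only [pow_two]; ring


/-! ### Competitors built from boxes -/

/-- Indicator of the box of half-side `L` whose bottom side is at height `H`. -/
noncomputable def boxF (H L : ℝ) : ℝ × ℝ → ℝ :=
  (Metric.closedBall ((0 : ℝ), H + L) L).indicator (fun _ => 1)

theorem mem_box_iff {c : ℝ × ℝ} {L : ℝ} {x : ℝ × ℝ} :
    x ∈ Metric.closedBall c L ↔ |x.1 - c.1| ≤ L ∧ |x.2 - c.2| ≤ L := by
  rw [Metric.mem_closedBall, dist_eq_norm, Prod.norm_def, max_le_iff]
  simp [Real.norm_eq_abs]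

theorem box_height {H L : ℝ} {x : ℝ × ℝ} (hx : x ∈ Metric.closedBall ((0 : ℝ), H + L) L) :
    H ≤ x.2 ∧ x.2 ≤ H + 2 * L := by
  have := (mem_box_iff.1 hx).2
  rw [abs_le] at this
  simp only at this
  constructor <;> linarith

theorem box_subset {H L : ℝ} (hH : 0 < H) : Metric.closedBall ((0 : ℝ), H + L) L ⊆ UHP :=
  fun _ hx => hH.trans_le (box_height hx).1

theorem box_meas (c : ℝ × ℝ) (L : ℝ) : MeasurableSet (Metric.closedBall c L) :=
  Metric.isClosed_closedBall.measurableSet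

theorem box_vol (c : ℝ × ℝ) {L : ℝ} (hL : 0 ≤ L) :
    volume.real (Metric.closedBall c L) = (2 * L) ^ 2 := by
  rw [show c = (c.1, c.2) from rfl, ← closedBall_prod_same, measureReal_def,
    Measure.volume_eq_prod, Measure.prod_prod, Real.volume_closedBall, Real.volume_closedBall,
    ENNReal.toReal_mul, ENNReal.toReal_ofReal (by positivity)]
  ring

theorem box_fin (c : ℝ × ℝ) (L : ℝ) : volume (Metric.closedBall c L) ≠ ⊤ :=
  (isCompact_closedBall c L).measure_lt_top.ne

theorem boxF_nonneg (H L : ℝ) (x : ℝ × ℝ) : 0 ≤ boxF H L x :=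
  Set.indicator_nonneg (fun _ _ => zero_le_one) x

theorem boxF_le_one (H L : ℝ) (x : ℝ × ℝ) : boxF H L x ≤ 1 :=
  Set.indicator_le' (fun _ _ => le_rfl) (fun _ _ => zero_le_one) x

theorem boxF_sq (H L : ℝ) (x : ℝ × ℝ) : boxF H L x ^ 2 = boxF H L x := by
  unfold boxF
  by_cases h : x ∈ Metric.closedBall ((0 : ℝ), H + L) L <;> simp [h]

theorem boxF_integrable (H L : ℝ) : IntegrableOn (boxF H L) UHP := by
  have : Integrable (boxF H L) := by
    unfold boxF
    rw [integrable_indicator_iff (box_meas _ _)]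
    exact integrableOn_const (box_fin _ _)
  exact this.integrableOn

theorem boxF_VV (H L : ℝ) : VV (boxF H L) :=
  ⟨boxF_integrable H L, by simpa only [boxF_sq] using boxF_integrable H L⟩

theorem integral_boxF {H L : ℝ} (hH : 0 < H) (hL : 0 ≤ L) :
    ∫ x in UHP, boxF H L x = (2 * L) ^ 2 := by
  unfold boxF
  rw [setIntegral_indicator (box_meas _ _), Set.inter_eq_right.2 (box_subset hH),
    setIntegral_const, box_vol _ hL]
  simp

theorem boxF_mom_integrable {H L : ℝ} (hH : 0 < H) :
    IntegrableOn (fun x => x.2 * boxF H L x) UHP := by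
  refine Integrable.mono' ((boxF_integrable H L).const_mul (H + 2 * L)) ?_
    (Eventually.of_forall fun x => ?_)
  · exact measurable_snd.aestronglyMeasurable.mul (boxF_integrable H L).aestronglyMeasurable
  · by_cases h : x ∈ Metric.closedBall ((0 : ℝ), H + L) L
    · have := box_height h
      have h2 : boxF H L x = 1 := by simp [boxF, h]
      rw [h2, Real.norm_of_nonneg (by linarith)]; linarith
    · have h2 : boxF H L x = 0 := by simp [boxF, h]
      simp [h2]

theorem impulse_boxF {H L : ℝ} (hH : 0 < H) (hL : 0 ≤ L) :
    H * (2 * L) ^ 2 ≤ impulse (boxF H L) := by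
  rw [← integral_boxF hH hL, ← integral_const_mul]
  refine integral_mono ((boxF_integrable H L).const_mul H) (boxF_mom_integrable hH) fun x => ?_
  by_cases h : x ∈ Metric.closedBall ((0 : ℝ), H + L) L
  · have := box_height h
    have h2 : boxF H L x = 1 := by simp [boxF, h]
    simp only [h2]; linarith
  · have h2 : boxF H L x = 0 := by simp [boxF, h]
    simp [h2]

theorem Efun_smul {lam : ℝ} {f : ℝ × ℝ → ℝ} (hf : VV f) (c : ℝ) :
    Efun lam (fun x => c * f x) = c ^ 2 * Efun lam f := by
  have h0 : VV (fun _ : ℝ × ℝ => (0 : ℝ)) := by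
    constructor <;> simp
  have := Efun_add_mul (lam := lam) h0 hf c
  simpa [NN, Efun, kineticE, BB, Gop] using this

theorem InAdm.vv {μ ν : ℝ} {η : ℝ × ℝ → ℝ} (h : InAdm μ ν η) : VV η := ⟨h.2.1, h.2.2.1⟩

/-! ### Boundedness of the energy -/
theorem Efun_bdd {lam μ ν : ℝ} (hlam : 1 < lam) (hν : 0 < ν) {η : ℝ × ℝ → ℝ} (h : InAdm μ ν η) :
    Efun lam η ≤ ν * C2 * (lam * ν) / 8 := by
  have hv := h.vv
  have hl : 0 < lam := by linarith
  set ε := 1 / (lam * ν) with hε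
  have hε0 : 0 < ε := by positivity
  set K := C2 / (4 * ε) + ε * ∫ y in UHP, (η y) ^ 2 with hK
  have hq : 0 ≤ ∫ y in UHP, (η y) ^ 2 := integral_nonneg fun _ => sq_nonneg _
  have hK0 : 0 ≤ K := by have := C2_nonneg; positivity
  have h1 : ∫ x in UHP, η x * Gop η x ≤ ν * K := by
    calc _ ≤ ∫ x in UHP, η x * K := by
          refine setIntegral_mono_on (mul_Gop_integrable hv hv) (hv.1.mul_const _) UHP_meas
            fun x hx => ?_
          exact mul_le_mul_of_nonneg_left ((le_abs_self _).trans (Gop_abs_le hv hx hε0)) (h.1 x hx)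
      _ = (∫ x in UHP, η x) * K := integral_mul_const _ _
      _ ≤ _ := mul_le_mul_of_nonneg_right h.2.2.2.2.2 hK0
  unfold Efun kineticE
  have e : 1 / 2 * (ν * K) = ν * C2 * (lam * ν) / 8 + 1 / (2 * lam) * ∫ y in UHP, (η y) ^ 2 := by
    rw [hK, hε]; field_simp; ring
  linarith

theorem le_of_max {lam μ ν : ℝ} (hlam : 1 < lam) (hν : 0 < ν) {ω η : ℝ × ℝ → ℝ}
    (hω : IsMaximizer lam μ ν ω) (h : InAdm μ ν η) : Efun lam η ≤ Efun lam ω := by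
  rw [hω.2]
  refine le_csSup ⟨ν * C2 * (lam * ν) / 8, ?_⟩ ⟨η, h, rfl⟩
  rintro s ⟨f, hf, rfl⟩
  exact Efun_bdd hlam hν hf

/-! ### Positivity of the maximal energy -/

noncomputable def gd (d : ℝ) : ℝ := ∫ z in Metric.closedBall (0 : ℝ × ℝ) d, PhiK z

theorem gd_tendsto : Tendsto gd atTop (nhds 1) := by
  rw [← integral_PhiK]
  exact (aecover_closedBall (x := (0 : ℝ × ℝ)) (μ := volume) tendsto_id
    ).integral_tendsto_of_countably_generated PhiK_integrable

theorem ball_PhiK (x : ℝ × ℝ) (d : ℝ) : ∫ y in Metric.closedBall x d, PhiK (x - y) = gd d := by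
  unfold gd
  rw [← integral_indicator (box_meas _ _), ← integral_indicator (box_meas _ _),
    
    ← integral_sub_left_eq_self ((Metric.closedBall (0 : ℝ × ℝ) d).indicator PhiK) volume x]
  congr 1; ext y
  by_cases h : y ∈ Metric.closedBall x d
  · have h2 : x - y ∈ Metric.closedBall (0 : ℝ × ℝ) d := by
      rw [mem_closedBall_zero_iff, ← dist_eq_norm, dist_comm]; exact h
    simp [h, h2]
  · have h2 : x - y ∉ Metric.closedBall (0 : ℝ × ℝ) d := by
      rw [mem_closedBall_zero_iff, ← dist_eq_norm, dist_comm]; exact h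
    simp only [h, h2, not_false_eq_true, Set.indicator_of_notMem]

theorem compl_PhiK (x : ℝ × ℝ) (d : ℝ) :
    ∫ y in (Metric.closedBall x d)ᶜ, PhiK (x - y) = 1 - gd d := by
  have h := integral_add_compl (box_meas x d) (PhiK_integrable.comp_sub_left x)
  have h2 : ∫ y, PhiK (x - y) = 1 := by
    rw [integral_sub_left_eq_self PhiK volume x, integral_PhiK]
  rw [ball_PhiK, h2] at h
  linarith

theorem Gop_box_ge {d L : ℝ} (hd : 0 < d) (hdL : d < L) {x : ℝ × ℝ}
    (hx : x ∈ Metric.closedBall ((0 : ℝ), L + L) (L - d)) :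
    2 * gd d - 1 ≤ Gop (boxF L L) x := by
  have hL : 0 < L := hd.trans hdL
  set B := Metric.closedBall ((0 : ℝ), L + L) L with hB
  have hi : ∀ x : ℝ × ℝ, Integrable (fun y => PhiK (x - y)) := fun x =>
    PhiK_integrable.comp_sub_left x
  have e : Gop (boxF L L) x = (∫ y in B, PhiK (x - y)) - ∫ y in B, PhiK (reflPt x - y) := by
    rw [← integral_sub (hi x).integrableOn (hi _).integrableOn]
    unfold Gop
    have : (fun y => GUHP x y * boxF L L y) = B.indicator (fun y => GUHP x y) := by
      ext y; by_cases h : y ∈ B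
      · simp [boxF, ← hB, h]
      · simp [boxF, ← hB, h]
    rw [this, setIntegral_indicator (box_meas _ _), Set.inter_eq_right.2 (box_subset hL)]
    rfl
  have h1 : gd d ≤ ∫ y in B, PhiK (x - y) := by
    rw [← ball_PhiK x d]
    refine setIntegral_mono_set (hi x).integrableOn (Eventually.of_forall fun y => PhiK_nonneg _)
      (LE.le.eventuallyLE ?_)
    refine Metric.closedBall_subset_closedBall' ?_
    have := Metric.mem_closedBall.1 hx
    linarith
  have h2 : ∫ y in B, PhiK (reflPt x - y) ≤ 1 - gd d := by
    rw [← compl_PhiK (reflPt x) d]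
    refine setIntegral_mono_set (hi _).integrableOn (Eventually.of_forall fun y => PhiK_nonneg _)
      (LE.le.eventuallyLE ?_)
    intro y hy hc
    have k1 := (box_height hy).1
    have k2 := (mem_box_iff.1 hc).2
    have k3 := (mem_box_iff.1 hx).2
    simp only [reflPt] at k2
    simp only at k3
    rw [abs_le] at k2 k3
    linarith
  rw [e]; linarith

theorem exists_pos {lam μ ν : ℝ} (hlam : 1 < lam) (hμ : 0 < μ) (hν : 0 < ν) :
    ∃ η, InAdm μ ν η ∧ 0 < Efun lam η := by
  have hl : 0 < lam := by linarith
  have hl1 : 1 / lam < 1 := by rw [div_lt_one hl]; exact hlam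
  have t1 : Tendsto (fun d => 2 * gd d - 1) atTop (nhds (2 * 1 - 1)) :=
    (gd_tendsto.const_mul 2).sub tendsto_const_nhds
  obtain ⟨d, hd1, hd⟩ := ((t1.eventually_const_lt (u := 1 / lam) (by linarith)).and
    (eventually_gt_atTop 0)).exists
  have t2 : Tendsto (fun L : ℝ => (1 - d / L) ^ 2 * (2 * gd d - 1)) atTop
      (nhds ((1 - 0) ^ 2 * (2 * gd d - 1))) :=
    ((tendsto_const_nhds.sub (tendsto_const_nhds.div_atTop tendsto_id)).pow 2).mul_const _
  obtain ⟨L, ⟨hL1, hdL⟩, hL2⟩ := ((t2.eventually_const_lt (u := 1 / lam) (by linarith)).and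
    (eventually_gt_atTop d) |>.and (eventually_ge_atTop (μ / ν))).exists
  have hL : 0 < L := hd.trans hdL
  set f := boxF L L with hf
  have hv : VV f := boxF_VV L L
  have hm : ∫ x in UHP, f x = (2 * L) ^ 2 := integral_boxF hL hL.le
  have hI : L * (2 * L) ^ 2 ≤ impulse f := impulse_boxF hL hL.le
  have hI0 : 0 < impulse f := lt_of_lt_of_le (by positivity) hI
  set In := Metric.closedBall ((0 : ℝ), L + L) (L - d) with hIn
  have hInU : In ⊆ UHP := by
    refine (Metric.closedBall_subset_closedBall (by linarith)).trans (box_subset (L := L) hL)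
  have k1 : (2 * (L - d)) ^ 2 * (2 * gd d - 1) ≤ ∫ x in UHP, f x * Gop f x := by
    have : ∫ x in UHP, In.indicator (fun _ => 2 * gd d - 1) x =
        (2 * (L - d)) ^ 2 * (2 * gd d - 1) := by
      rw [setIntegral_indicator (box_meas _ _), Set.inter_eq_right.2 hInU, setIntegral_const,
        box_vol _ (by linarith), smul_eq_mul]
    rw [← this]
    refine setIntegral_mono_on ?_ (mul_Gop_integrable hv hv) UHP_meas fun x hx => ?_
    · exact ((integrable_indicator_iff (box_meas _ _)).2
        (integrableOn_const (box_fin _ _))).integrableOn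
    · by_cases h : x ∈ In
      · have hx1 : f x = 1 := by
          have : x ∈ Metric.closedBall ((0 : ℝ), L + L) L :=
            Metric.closedBall_subset_closedBall (by linarith) h
          simp [hf, boxF, this]
        rw [hx1, one_mul, Set.indicator_of_mem h]
        exact Gop_box_ge hd hdL h
      · rw [Set.indicator_of_notMem h]
        exact mul_nonneg (boxF_nonneg _ _ _) (Gop_nonneg (fun y _ => boxF_nonneg _ _ _) hx)
  have k2 : 0 < Efun lam f := by
    unfold Efun kineticE
    have e2 : ∫ x in UHP, f x ^ 2 = (2 * L) ^ 2 := by simp only [hf, boxF_sq]; rw [← hf, hm]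
    rw [e2]
    have e3 : (2 * (L - d)) ^ 2 * (2 * gd d - 1) =
        (2 * L) ^ 2 * ((1 - d / L) ^ 2 * (2 * gd d - 1)) := by field_simp
    have e4 : (2 * L) ^ 2 * (1 / lam) < (2 * L) ^ 2 * ((1 - d / L) ^ 2 * (2 * gd d - 1)) :=
      mul_lt_mul_of_pos_left hL1 (by positivity)
    rw [show (1 / (2 * lam) : ℝ) = 1 / lam / 2 by rw [div_div, mul_comm]]
    nlinarith
  set c := μ / impulse f with hc
  have hc0 : 0 < c := div_pos hμ hI0
  refine ⟨fun x => c * f x, ⟨fun x _ => mul_nonneg hc0.le (boxF_nonneg _ _ _),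
    (hv.const_mul c).1, (hv.const_mul c).2, ?_, ?_, ?_⟩, ?_⟩
  · refine ((boxF_mom_integrable (L := L) hL).const_mul c).congr
      (Eventually.of_forall fun x => ?_)
    simp only [hf]; ring
  · have : impulse (fun x => c * f x) = c * impulse f := by
      unfold impulse
      rw [← integral_const_mul]
      congr 1; ext x; ring
    rw [this, hc]; field_simp
  · rw [integral_const_mul, hm, hc]
    rw [div_mul_eq_mul_div, div_le_iff₀ hI0]
    rw [div_le_iff₀ hν] at hL2
    calc μ * (2 * L) ^ 2 ≤ (L * ν) * (2 * L) ^ 2 := by gcongr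
      _ = ν * (L * (2 * L) ^ 2) := by ring
      _ ≤ _ := by gcongr
  · rw [Efun_smul hv]; positivity


/-! ### First variation -/

theorem NN_nonpos {lam μ ν : ℝ} (hlam : 1 < lam) (hν : 0 < ν) {ω h : ℝ × ℝ → ℝ}
    (hω : IsMaximizer lam μ ν ω) (hh : VV h)
    (hadm : ∀ t : ℝ, 0 < t → t ≤ 1 → InAdm μ ν (fun x => ω x + t * h x)) :
    NN lam h ω ≤ 0 := by
  by_contra! hn
  set n := NN lam h ω
  set e := Efun lam h
  have key : ∀ t : ℝ, 0 < t → t ≤ 1 → n + t * e ≤ 0 := by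
    intro t ht ht1
    have h1 := le_of_max hlam hν hω (hadm t ht ht1)
    rw [Efun_add_mul hω.1.vv hh] at h1
    have h2 : t * (n + t * e) ≤ 0 := by
      change Efun lam ω + t * n + t ^ 2 * e ≤ _ at h1
      nlinarith
    by_contra! h3
    have := mul_pos ht h3
    linarith
  have hpos : 0 < n / (2 * (|e| + 1)) := by positivity
  have ht := key (min 1 (n / (2 * (|e| + 1)))) (lt_min one_pos hpos) (min_le_left _ _)
  have h4 : min 1 (n / (2 * (|e| + 1))) ≤ n / (2 * (|e| + 1)) := min_le_right _ _
  have h5 : 0 < min 1 (n / (2 * (|e| + 1))) := lt_min one_pos hpos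
  set t := min 1 (n / (2 * (|e| + 1)))
  rw [le_div_iff₀ (by positivity)] at h4
  have h6 := neg_abs_le e
  nlinarith

theorem pert {lam μ ν : ℝ} (hlam : 1 < lam) (hν : 0 < ν) {ω h0 : ℝ × ℝ → ℝ}
    (hω : IsMaximizer lam μ ν ω) {A : Set (ℝ × ℝ)} (hA : MeasurableSet A)
    (h0v : VV h0) (h0n : ∀ x, 0 ≤ h0 x) (h0i : IntegrableOn (fun x => x.2 * h0 x) UHP)
    (h0m : impulse h0 = 1) {α β : ℝ} (hα : 0 ≤ α) (hβ : 0 ≤ β)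
    (h1 : α * μ - impulse (A.indicator ω) + β = 0)
    (h2 : α * ν - (∫ x in UHP, A.indicator ω x) + β * (∫ x in UHP, h0 x) ≤ 0) :
    α * NN lam ω ω - NN lam (A.indicator ω) ω + β * NN lam h0 ω ≤ 0 := by
  obtain ⟨hpos, hL1, hL2, hI, himp, hmass⟩ := hω.1
  have hv : VV ω := ⟨hL1, hL2⟩
  have hAv : VV (A.indicator ω) := hv.indicator hA
  have hAI : IntegrableOn (fun x => x.2 * A.indicator ω x) UHP := by
    refine (hI.indicator hA).congr (Eventually.of_forall fun x => ?_)
    by_cases h : x ∈ A <;> simp [h]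
  have hv1 : VV (fun x => α * ω x + (-1) * A.indicator ω x) :=
    (hv.const_mul α).add (hAv.const_mul (-1))
  have hv2 : VV (fun x => (α * ω x + (-1) * A.indicator ω x) + β * h0 x) :=
    hv1.add (h0v.const_mul β)
  have hN := NN_nonpos hlam hν hω hv2 ?_
  · have hz : NN lam (fun x => α * ω x) ω = α * NN lam ω ω := by
      have h0 : VV (fun _ : ℝ × ℝ => (0 : ℝ)) := by constructor <;> simp
      have := NN_add_mul (lam := lam) h0 hv hv α
      simpa [NN, BB] using this
    rw [NN_add_mul hv1 h0v hv, NN_add_mul (hv.const_mul α) hAv hv, hz] at hN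
    linarith
  · intro t ht ht1
    refine ⟨fun x hx => ?_, (hv.add (hv2.const_mul t)).1, (hv.add (hv2.const_mul t)).2, ?_, ?_, ?_⟩
    · have a1 := hpos x hx
      have a2 : A.indicator ω x ≤ ω x := by
        by_cases h : x ∈ A
        · simp [h]
        · simp [h, a1]
      have a3 : 0 ≤ t * (α * ω x) := by positivity
      have a4 : 0 ≤ t * (β * h0 x) := mul_nonneg ht.le (mul_nonneg hβ (h0n x))
      nlinarith
    · have := hI.add (((hI.const_mul α).add ((hAI.const_mul (-1)).add (h0i.const_mul β))).const_mul t)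
      refine this.congr (Eventually.of_forall fun x => ?_)
      simp only [Pi.add_apply]; ring
    · have e : impulse (fun x => ω x + t * ((α * ω x + (-1) * A.indicator ω x) + β * h0 x)) =
          impulse ω + (t * α) * impulse ω + (-t) * impulse (A.indicator ω) +
            (t * β) * impulse h0 := by
        unfold impulse
        rw [← int_lin4 hI hI hAI h0i]
        congr 1; ext x; ring
      rw [e, himp, h0m]
      linear_combination t * h1
    · have e : ∫ x in UHP, (ω x + t * ((α * ω x + (-1) * A.indicator ω x) + β * h0 x)) =
          (∫ x in UHP, ω x) + (t * α) * (∫ x in UHP, ω x) +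
            (-t) * (∫ x in UHP, A.indicator ω x) + (t * β) * ∫ x in UHP, h0 x := by
        rw [← int_lin4 hL1 hL1 hAv.1 h0v.1]
        congr 1; ext x; ring
      rw [e]
      have a1 : t * (α * ∫ x in UHP, ω x) ≤ t * (α * ν) := by gcongr
      nlinarith

/-- Energy density of the first variation. -/
noncomputable def qd (lam : ℝ) (ω : ℝ × ℝ → ℝ) (x : ℝ × ℝ) : ℝ :=
  ω x * Gop ω x - (1 / lam) * (ω x) ^ 2

theorem qd_integrable {lam : ℝ} {ω : ℝ × ℝ → ℝ} (hv : VV ω) : IntegrableOn (qd lam ω) UHP :=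
  (mul_Gop_integrable hv hv).sub (hv.2.const_mul _)

theorem NN_indicator {lam : ℝ} {ω : ℝ × ℝ → ℝ} (hv : VV ω) {A : Set (ℝ × ℝ)}
    (hA : MeasurableSet A) :
    NN lam (A.indicator ω) ω = ∫ x in A, qd lam ω x ∂(volume.restrict UHP) := by
  have hAv := hv.indicator hA
  unfold NN BB
  rw [← integral_const_mul, ← integral_sub (mul_Gop_integrable hAv hv)
    ((hAv.mul hv).const_mul _), ← integral_indicator hA]
  congr 1; ext x
  by_cases h : x ∈ A
  · simp only [Set.indicator_of_mem h, qd]; ring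
  · simp [h]

theorem mass_indicator (ω : ℝ × ℝ → ℝ) {A : Set (ℝ × ℝ)} (hA : MeasurableSet A) :
    ∫ x in UHP, A.indicator ω x = ∫ x in A, ω x ∂(volume.restrict UHP) :=
  integral_indicator hA

theorem impulse_indicator (ω : ℝ × ℝ → ℝ) {A : Set (ℝ × ℝ)} (hA : MeasurableSet A) :
    impulse (A.indicator ω) = ∫ x in A, x.2 * ω x ∂(volume.restrict UHP) := by
  unfold impulse
  rw [← integral_indicator hA]
  congr 1; ext x
  by_cases h : x ∈ A <;> simp [h]

/-- High competitor. -/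
theorem exists_high {lam : ℝ} (hlam : 1 < lam) {ω : ℝ × ℝ → ℝ} (hv : VV ω)
    (hpos : ∀ x ∈ UHP, 0 ≤ ω x) {H : ℝ} (hH : 0 < H) :
    ∃ h0, VV h0 ∧ (∀ x, 0 ≤ h0 x) ∧ IntegrableOn (fun x => x.2 * h0 x) UHP ∧ impulse h0 = 1 ∧
      (∫ x in UHP, h0 x) ≤ 1 / H ∧ -((∫ x in UHP, ω x) / H) ≤ NN lam h0 ω := by
  set f := boxF H 1 with hf
  have hfv : VV f := boxF_VV H 1
  have hm : ∫ x in UHP, f x = (2 * 1) ^ 2 := integral_boxF hH zero_le_one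
  have hI : H * (2 * 1) ^ 2 ≤ impulse f := impulse_boxF hH zero_le_one
  have hI0 : 0 < impulse f := lt_of_lt_of_le (by positivity) hI
  set c := (impulse f)⁻¹ with hc
  have hc0 : 0 < c := inv_pos.2 hI0
  have hcH : 4 * c ≤ 1 / H := by
    rw [hc, ← div_eq_mul_inv, div_le_div_iff₀ hI0 hH]; linarith
  have hn : ∀ x, 0 ≤ c * f x := fun x => mul_nonneg hc0.le (boxF_nonneg _ _ _)
  have hcv := hfv.const_mul c
  have hm0 : 0 ≤ ∫ x in UHP, ω x := setIntegral_nonneg UHP_meas hpos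
  refine ⟨fun x => c * f x, hcv, hn, ?_, ?_, ?_, ?_⟩
  · refine ((boxF_mom_integrable (L := 1) hH).const_mul c).congr
      (Eventually.of_forall fun x => ?_)
    simp only [hf]; ring
  · have : impulse (fun x => c * f x) = c * impulse f := by
      unfold impulse
      rw [← integral_const_mul]
      congr 1; ext x; ring
    rw [this, hc]; field_simp
  · rw [integral_const_mul, hm]; linarith
  · have b1 : 0 ≤ BB (fun x => c * f x) ω :=
      setIntegral_nonneg UHP_meas fun x hx => mul_nonneg (hn x) (Gop_nonneg hpos hx)
    have b2 : ∫ x in UHP, c * f x * ω x ≤ (∫ x in UHP, ω x) / H := by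
      calc _ ≤ ∫ x in UHP, c * ω x := by
            refine setIntegral_mono_on (hcv.mul hv) (hv.1.const_mul c) UHP_meas fun x hx => ?_
            have := mul_le_mul_of_nonneg_right (boxF_le_one H 1 x) (hpos x hx)
            rw [one_mul] at this
            rw [mul_assoc]
            exact mul_le_mul_of_nonneg_left this hc0.le
        _ = c * ∫ x in UHP, ω x := integral_const_mul _ _
        _ ≤ (1 / H) * ∫ x in UHP, ω x := by
            apply mul_le_mul_of_nonneg_right _ hm0
            linarith
        _ = _ := by ring
    have b3 : 0 ≤ ∫ x in UHP, c * f x * ω x :=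
      setIntegral_nonneg UHP_meas fun x hx => mul_nonneg (hn x) (hpos x hx)
    have b4 : 1 / lam ≤ 1 := by rw [div_le_one (by linarith)]; exact hlam.le
    unfold NN
    nlinarith

/-! ### Euler-Lagrange inequality -/
theorem EL_low {lam μ ν : ℝ} (hlam : 1 < lam) (hμ : 0 < μ) (hν : 0 < ν) {ω : ℝ × ℝ → ℝ}
    (hω : IsMaximizer lam μ ν ω) {A : Set (ℝ × ℝ)} (hA : MeasurableSet A)
    (hlow : ∀ x ∈ A, x.2 ≤ μ / ν) :
    0 ≤ ∫ x in A, (qd lam ω x - (2 * Efun lam ω / μ) * (x.2 * ω x)) ∂(volume.restrict UHP) := by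
  obtain ⟨hpos, hL1, hL2, hI, himp, hmass⟩ := hω.1
  have hv : VV ω := ⟨hL1, hL2⟩
  obtain ⟨h0, k1, k2, k3, k4, -, -⟩ := exists_high hlam hv hpos one_pos
  have hi0 : 0 ≤ impulse (A.indicator ω) := by
    refine setIntegral_nonneg UHP_meas fun x hx => mul_nonneg (le_of_lt hx) ?_
    by_cases h : x ∈ A
    · simpa [h] using hpos x hx
    · simp [h]
  have hAI : IntegrableOn (fun x => x.2 * ω x) A (volume.restrict UHP) := Integrable.restrict hI
  have hA1 : IntegrableOn ω A (volume.restrict UHP) := Integrable.restrict hL1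
  have hP := pert hlam hν hω hA k1 k2 k3 k4 (α := impulse (A.indicator ω) / μ) (β := 0)
    (by positivity) le_rfl (by field_simp; ring) ?_
  · rw [NN_self, NN_indicator hv hA, zero_mul, add_zero] at hP
    rw [integral_sub (Integrable.restrict (qd_integrable hv)) (hAI.const_mul _), integral_const_mul,
      ← impulse_indicator ω hA]
    have : impulse (A.indicator ω) / μ * (2 * Efun lam ω) =
      2 * Efun lam ω / μ * impulse (A.indicator ω) := by ring
    linarith
  · rw [zero_mul, add_zero, mass_indicator ω hA, impulse_indicator ω hA, sub_nonpos]
    rw [div_mul_eq_mul_div, div_le_iff₀ hμ, ← integral_mul_const, ← integral_mul_const]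
    refine integral_mono_ae (hAI.mul_const _) (hA1.mul_const _) ?_
    filter_upwards [ae_restrict_mem hA, ae_restrict_of_ae (ae_restrict_mem UHP_meas)] with x h1 h2
    have := hlow x h1
    rw [le_div_iff₀ hν] at this
    nlinarith [hpos x h2]

theorem EL_high {lam μ ν : ℝ} (hlam : 1 < lam) (hμ : 0 < μ) (hν : 0 < ν) {ω : ℝ × ℝ → ℝ}
    (hω : IsMaximizer lam μ ν ω) {A : Set (ℝ × ℝ)} (hA : MeasurableSet A)
    (hhigh : ∀ x ∈ A, μ / ν ≤ x.2) :
    0 ≤ ∫ x in A, (qd lam ω x - (2 * Efun lam ω / (2 * ν)) * ω x) ∂(volume.restrict UHP) := by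
  obtain ⟨hpos, hL1, hL2, hI, himp, hmass⟩ := hω.1
  have hv : VV ω := ⟨hL1, hL2⟩
  have hAI : IntegrableOn (fun x => x.2 * ω x) A (volume.restrict UHP) := Integrable.restrict hI
  have hA1 : IntegrableOn ω A (volume.restrict UHP) := Integrable.restrict hL1
  have hnn : ∀ᵐ x ∂((volume.restrict UHP).restrict A), 0 ≤ ω x := by
    filter_upwards [ae_restrict_of_ae (ae_restrict_mem UHP_meas)] with x h2 using hpos x h2
  have hm0 : 0 ≤ ∫ x in A, ω x ∂(volume.restrict UHP) := integral_nonneg_of_ae hnn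
  rcases hm0.eq_or_lt with hz | hmp
  · have hz' := (integral_eq_zero_iff_of_nonneg_ae hnn hA1).1 hz.symm
    refine le_of_eq (Eq.symm ?_)
    apply integral_eq_zero_of_ae
    filter_upwards [hz'] with x hx
    have : ω x = 0 := hx
    simp [qd, this]
  set mA := ∫ x in A, ω x ∂(volume.restrict UHP) with hmA
  set iA := ∫ x in A, x.2 * ω x ∂(volume.restrict UHP) with hiA
  have hib : μ / ν * mA ≤ iA := by
    rw [hmA, hiA, ← integral_const_mul]
    refine integral_mono_ae (hA1.const_mul _) hAI ?_
    filter_upwards [ae_restrict_mem hA, hnn] with x h1 h2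
    exact mul_le_mul_of_nonneg_right (hhigh x h1) h2
  set m := ∫ x in UHP, ω x with hm
  set α := mA / (2 * ν) with hα
  set β := iA - α * μ with hβ
  have hα0 : 0 ≤ α := by positivity
  have hβ0 : 0 ≤ β := by
    have : α * μ = (μ / ν * mA) / 2 := by rw [hα]; field_simp
    have h3 : 0 ≤ μ / ν * mA := by positivity
    rw [hβ, this]; linarith
  have main : ∀ᶠ H : ℝ in atTop, α * (2 * Efun lam ω) - β * m / H ≤
      ∫ x in A, qd lam ω x ∂(volume.restrict UHP) := by
    filter_upwards [eventually_gt_atTop 0, eventually_ge_atTop (2 * β / mA)] with H hH hH2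
    obtain ⟨h0, k1, k2, k3, k4, k5, k6⟩ := exists_high hlam hv hpos hH
    have hP := pert hlam hν hω hA k1 k2 k3 k4 (α := α) (β := β) hα0 hβ0
      (by rw [impulse_indicator ω hA]; simp only [hβ]; ring) ?_
    · rw [NN_self, NN_indicator hv hA] at hP
      have := mul_le_mul_of_nonneg_left k6 hβ0
      have e : β * -(m / H) = -(β * m / H) := by ring
      rw [← hm, e] at this
      linarith
    · rw [mass_indicator ω hA, ← hmA]
      have e1 : α * ν = mA / 2 := by rw [hα]; field_simp
      have e2 := mul_le_mul_of_nonneg_left k5 hβ0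
      have e3 : β * (1 / H) ≤ mA / 2 := by
        rw [div_le_iff₀ hmp] at hH2
        rw [mul_one_div, div_le_div_iff₀ hH two_pos]; linarith
      linarith
  have lim : Tendsto (fun H : ℝ => α * (2 * Efun lam ω) - β * m / H) atTop
      (nhds (α * (2 * Efun lam ω) - 0)) :=
    tendsto_const_nhds.sub (tendsto_const_nhds.div_atTop tendsto_id)
  have fin := le_of_tendsto lim main
  rw [integral_sub (Integrable.restrict (qd_integrable hv)) (hA1.const_mul _), integral_const_mul, ← hmA]
  have : α * (2 * Efun lam ω) = 2 * Efun lam ω / (2 * ν) * mA := by rw [hα]; ring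
  linarith

theorem EL {lam μ ν : ℝ} (hlam : 1 < lam) (hμ : 0 < μ) (hν : 0 < ν) {ω : ℝ × ℝ → ℝ}
    (hω : IsMaximizer lam μ ν ω) :
    ∃ c : ℝ, 0 < c ∧ ∀ᵐ x ∂(volume.restrict UHP), 0 < ω x →
      c * min 1 x.2 + (1 / lam) * ω x ≤ Gop ω x := by
  have hI := hω.1.2.2.2.1
  have hv : VV ω := hω.1.vv
  have hE : 0 < Efun lam ω := by
    obtain ⟨η, h1, h2⟩ := exists_pos hlam hμ hν
    exact h2.trans_le (le_of_max hlam hν hω h1)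
  set E := Efun lam ω with hEdef
  set T : Set (ℝ × ℝ) := {x | x.2 ≤ μ / ν} with hT
  have hTm : MeasurableSet T := measurableSet_le measurable_snd measurable_const
  have a1 : ∀ᵐ x ∂((volume.restrict UHP).restrict T),
      0 ≤ qd lam ω x - (2 * E / μ) * (x.2 * ω x) := by
    refine ae_nonneg_of_forall_setIntegral_nonneg
      (Integrable.restrict ((qd_integrable hv).sub (hI.const_mul _))) fun s hs _ => ?_
    rw [Measure.restrict_restrict hs]
    exact EL_low hlam hμ hν hω (hs.inter hTm) fun x hx => hx.2
  have a2 : ∀ᵐ x ∂((volume.restrict UHP).restrict Tᶜ),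
      0 ≤ qd lam ω x - (2 * E / (2 * ν)) * ω x := by
    refine ae_nonneg_of_forall_setIntegral_nonneg
      (Integrable.restrict ((qd_integrable hv).sub (hv.1.const_mul _))) fun s hs _ => ?_
    rw [Measure.restrict_restrict hs]
    exact EL_high hlam hμ hν hω (hs.inter hTm.compl) fun x hx => (not_le.1 (show ¬ x.2 ≤ μ / ν from hx.2)).le
  rw [ae_restrict_iff' hTm] at a1
  rw [ae_restrict_iff' hTm.compl] at a2
  refine ⟨min (2 * E / μ) (2 * E / (2 * ν)), by positivity, ?_⟩
  filter_upwards [a1, a2, ae_restrict_mem UHP_meas] with x h1 h2 hx hωx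
  have hx' : 0 < x.2 := hx
  set c := min (2 * E / μ) (2 * E / (2 * ν)) with hc
  have hc0 : 0 < c := by positivity
  by_cases hxT : x ∈ T
  · have k := h1 hxT
    have k2 : 0 ≤ ω x * (Gop ω x - (1 / lam) * ω x - 2 * E / μ * x.2) := by
      unfold qd at k; linarith
    have k3 := nonneg_of_mul_nonneg_right k2 hωx
    have k4 : c * min 1 x.2 ≤ 2 * E / μ * x.2 :=
      mul_le_mul (min_le_left _ _) (min_le_right _ _) (by positivity) (by positivity)
    linarith
  · have k := h2 hxT
    have k2 : 0 ≤ ω x * (Gop ω x - (1 / lam) * ω x - 2 * E / (2 * ν)) := by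
      unfold qd at k; linarith
    have k3 := nonneg_of_mul_nonneg_right k2 hωx
    have k4 : c * min 1 x.2 ≤ 2 * E / (2 * ν) * 1 :=
      mul_le_mul (min_le_right _ _) (min_le_left _ _) (by positivity) (by positivity)
    linarith


/-! ### Decay and conclusion -/

/-- Whole-plane potential. -/
noncomputable def Pot (ω : ℝ × ℝ → ℝ) (x : ℝ × ℝ) : ℝ := ∫ y in UHP, PhiK (x - y) * ω y

theorem PhiK_slice (x : ℝ × ℝ) : IntegrableOn (fun y => PhiK (x - y) ^ 2) UHP :=
  (PhiK_sq_integrable.comp_sub_left x).integrableOn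

theorem PhiK_slice_le (x : ℝ × ℝ) : ∫ y in UHP, PhiK (x - y) ^ 2 ≤ C2 := by
  have : ∫ y, PhiK (x - y) ^ 2 = C2 := integral_sub_left_eq_self (fun z => PhiK z ^ 2) volume x
  rw [← this]
  exact setIntegral_le_integral (PhiK_sq_integrable.comp_sub_left x)
    (Eventually.of_forall fun y => sq_nonneg _)

theorem PhiK_slice_meas (x : ℝ × ℝ) : Measurable (fun y => PhiK (x - y)) :=
  PhiK_meas.comp (measurable_const.sub measurable_id)

theorem Pot_slice {ω : ℝ × ℝ → ℝ} (hv : VV ω) (x : ℝ × ℝ) :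
    IntegrableOn (fun y => PhiK (x - y) * ω y) UHP := by
  refine Integrable.mono' ((PhiK_slice x).add hv.2)
    ((PhiK_slice_meas x).aestronglyMeasurable.mul hv.1.aestronglyMeasurable)
    (Eventually.of_forall fun y => ?_)
  simp only [Pi.add_apply, Real.norm_eq_abs]
  rw [abs_le]
  constructor <;> nlinarith [sq_nonneg (PhiK (x - y) + ω y), sq_nonneg (PhiK (x - y) - ω y),
    sq_nonneg (ω y), sq_nonneg (PhiK (x - y))]

theorem Pot_nonneg {ω : ℝ × ℝ → ℝ} (hpos : ∀ x ∈ UHP, 0 ≤ ω x) (x : ℝ × ℝ) : 0 ≤ Pot ω x :=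
  setIntegral_nonneg UHP_meas fun y hy => mul_nonneg (PhiK_nonneg _) (hpos y hy)

theorem Pot_le {ω : ℝ × ℝ → ℝ} (hv : VV ω) (x : ℝ × ℝ) :
    Pot ω x ≤ C2 + ∫ y in UHP, (ω y) ^ 2 := by
  have h1 : Pot ω x ≤ ∫ y in UHP, (PhiK (x - y) ^ 2 + (ω y) ^ 2) := by
    refine integral_mono (Pot_slice hv x) ((PhiK_slice x).add hv.2) fun y => ?_
    simp only
    nlinarith [sq_nonneg (PhiK (x - y) - ω y), sq_nonneg (ω y), sq_nonneg (PhiK (x - y))]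
  rw [integral_add (PhiK_slice x) hv.2] at h1
  linarith [PhiK_slice_le x]

theorem Pot_meas {ω : ℝ × ℝ → ℝ} (hv : VV ω) : AEStronglyMeasurable (Pot ω) volume := by
  have h : AEStronglyMeasurable (fun p : (ℝ × ℝ) × (ℝ × ℝ) => PhiK (p.1 - p.2) * ω p.2)
      ((volume : Measure (ℝ × ℝ)).prod (volume.restrict UHP)) :=
    (PhiK_meas.comp (measurable_fst.sub measurable_snd)).aestronglyMeasurable.mul
      hv.1.aestronglyMeasurable.comp_snd
  exact h.integral_prod_right'

theorem cocompact_cg : (cocompact (ℝ × ℝ)).IsCountablyGenerated := by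
  rw [← Metric.cobounded_eq_cocompact, ← comap_norm_atTop]
  infer_instance

theorem tendsto_sub_cocompact (y : ℝ × ℝ) :
    Tendsto (fun x : ℝ × ℝ => x - y) (cocompact (ℝ × ℝ)) (cocompact (ℝ × ℝ)) :=
  (Homeomorph.subRight y).isClosedEmbedding.tendsto_cocompact

theorem Gop_le_Pot {ω : ℝ × ℝ → ℝ} (hv : VV ω) (hpos : ∀ x ∈ UHP, 0 ≤ ω x) (x : ℝ × ℝ) :
    Gop ω x ≤ Pot ω x :=
  setIntegral_mono_on (slice_integrable hv x) (Pot_slice hv x) UHP_meas fun y hy =>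
    mul_le_mul_of_nonneg_right (GUHP_le x y) (hpos y hy)

theorem Pot_tendsto {ω : ℝ × ℝ → ℝ} (hv : VV ω) (hpos : ∀ x ∈ UHP, 0 ≤ ω x) :
    Tendsto (Pot ω) (cocompact (ℝ × ℝ)) (nhds 0) := by
  have key : ∀ ε : ℝ, 0 < ε → ∀ᶠ x in cocompact (ℝ × ℝ), Pot ω x < ε * C2 + ε := by
    intro ε hε
    set r : (ℝ × ℝ) → (ℝ × ℝ) → ℝ := fun x y => max (PhiK (x - y) * ω y - ε * PhiK (x - y) ^ 2) 0
      with hr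
    have rm : ∀ x, AEStronglyMeasurable (r x) (volume.restrict UHP) := fun x =>
      ((((PhiK_slice_meas x).aestronglyMeasurable.mul hv.1.aestronglyMeasurable).sub
        (((PhiK_slice_meas x).pow_const 2).const_mul ε).aestronglyMeasurable)).sup
        aestronglyMeasurable_const
    have rb : ∀ x y, ‖r x y‖ ≤ (1 / (4 * ε)) * (ω y) ^ 2 := by
      intro x y
      rw [Real.norm_of_nonneg (le_max_right _ _)]
      apply max_le
      · set a := PhiK (x - y)
        have e : (1 / (4 * ε)) * (ω y) ^ 2 - (a * ω y - ε * a ^ 2) =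
            (1 / (4 * ε)) * (ω y - 2 * ε * a) ^ 2 := by field_simp; ring
        have : 0 ≤ (1 / (4 * ε)) * (ω y - 2 * ε * a) ^ 2 := by positivity
        linarith
      · positivity
    have ri : ∀ x, IntegrableOn (r x) UHP := fun x =>
      Integrable.mono' (hv.2.const_mul _) (rm x) (Eventually.of_forall (rb x))
    have lim : Tendsto (fun x => ∫ y in UHP, r x y) (cocompact (ℝ × ℝ))
        (nhds (∫ y in UHP, (0 : ℝ))) := by
      have := cocompact_cg
      refine tendsto_integral_filter_of_dominated_convergence
        (fun y => (1 / (4 * ε)) * (ω y) ^ 2) (Eventually.of_forall rm)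
        (Eventually.of_forall fun x => Eventually.of_forall (rb x)) (hv.2.const_mul _)
        (Eventually.of_forall fun y => ?_)
      have t1 : Tendsto (fun x => PhiK (x - y)) (cocompact (ℝ × ℝ)) (nhds 0) :=
        PhiK_tendsto.comp (tendsto_sub_cocompact y)
      have t2 := ((t1.mul_const (ω y)).sub ((t1.pow 2).const_mul ε)).max
        (tendsto_const_nhds (x := (0 : ℝ)))
      simpa using t2
    rw [integral_zero] at lim
    filter_upwards [lim.eventually_lt_const hε] with x hx
    have h1 : Pot ω x ≤ ∫ y in UHP, (ε * PhiK (x - y) ^ 2 + r x y) := by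
      refine integral_mono (Pot_slice hv x) (((PhiK_slice x).const_mul ε).add (ri x)) fun y => ?_
      have : PhiK (x - y) * ω y - ε * PhiK (x - y) ^ 2 ≤ r x y := le_max_left _ _
      simp only
      linarith
    rw [integral_add ((PhiK_slice x).const_mul ε) (ri x), integral_const_mul] at h1
    have := mul_le_mul_of_nonneg_left (PhiK_slice_le x) hε.le
    linarith
  refine tendsto_order.2 ⟨fun a ha => Eventually.of_forall fun x =>
    ha.trans_le (Pot_nonneg hpos x), fun a ha => ?_⟩
  have hC := C2_nonneg
  filter_upwards [key (a / (C2 + 1)) (by positivity)] with x hx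
  have : a / (C2 + 1) * C2 + a / (C2 + 1) = a := by field_simp
  linarith

theorem HPot_tendsto {ω : ℝ × ℝ → ℝ} (hv : VV ω) (hpos : ∀ x ∈ UHP, 0 ≤ ω x) :
    (∀ x, Integrable (fun z => HK z * Pot ω (x - z))) ∧
    Tendsto (fun x => ∫ z, HK z * Pot ω (x - z)) (cocompact (ℝ × ℝ)) (nhds 0) := by
  set M := C2 + ∫ y in UHP, (ω y) ^ 2 with hM
  have hm : ∀ x, AEStronglyMeasurable (fun z => HK z * Pot ω (x - z)) volume := fun x =>
    HK_meas.aestronglyMeasurable.mul ((Pot_meas hv).comp_quasiMeasurePreserving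
      (Measure.measurePreserving_sub_left volume x).quasiMeasurePreserving)
  have hb : ∀ x z, ‖HK z * Pot ω (x - z)‖ ≤ HK z * M := by
    intro x z
    rw [Real.norm_of_nonneg (mul_nonneg (HK_nonneg z) (Pot_nonneg hpos _))]
    exact mul_le_mul_of_nonneg_left (Pot_le hv _) (HK_nonneg z)
  refine ⟨fun x => Integrable.mono' (HK_integrable.mul_const M) (hm x)
    (Eventually.of_forall (hb x)), ?_⟩
  have lim : Tendsto (fun x => ∫ z, HK z * Pot ω (x - z)) (cocompact (ℝ × ℝ))
      (nhds (∫ _z : ℝ × ℝ, (0 : ℝ))) := by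
    have := cocompact_cg
    refine tendsto_integral_filter_of_dominated_convergence
      (fun z => HK z * M) (Eventually.of_forall hm)
      (Eventually.of_forall fun x => Eventually.of_forall (hb x)) (HK_integrable.mul_const M)
      (Eventually.of_forall fun z => ?_)
    have := ((Pot_tendsto hv hpos).comp (tendsto_sub_cocompact z)).const_mul (HK z)
    simpa using this
  simpa using lim

theorem rad_le_norm (x : ℝ × ℝ) : rad x ≤ 2 * ‖x‖ := by
  unfold rad
  apply Real.sqrt_le_iff.2
  have h1 : |x.1| ≤ ‖x‖ := norm_fst_le x
  have h2 : |x.2| ≤ ‖x‖ := norm_snd_le x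
  refine ⟨by positivity, ?_⟩
  have h3 := sq_le_sq' (by linarith [abs_nonneg x.1, norm_nonneg x]) h1
  have h4 := sq_le_sq' (by linarith [abs_nonneg x.2, norm_nonneg x]) h2
  rw [sq_abs] at h3 h4
  nlinarith [sq_nonneg ‖x‖]

theorem compact_support {lam μ ν : ℝ} (hlam : 1 < lam) (hμ : 0 < μ) (hν : 0 < ν)
    {ω : ℝ × ℝ → ℝ} (hω : IsMaximizer lam μ ν ω) :
    ∃ R : ℝ, 0 < R ∧ ∀ᵐ x ∂(volume.restrict UHP), R ≤ rad x → ω x = 0 := by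
  obtain ⟨c, hc, hEL⟩ := EL hlam hμ hν hω
  have hpos := hω.1.1
  have hv : VV ω := hω.1.vv
  have hlam0 : 0 < lam := by linarith
  -- pointwise bound
  have hle : ∀ᵐ x ∂(volume.restrict UHP), ω x ≤ lam * Pot ω x := by
    filter_upwards [hEL, ae_restrict_mem UHP_meas] with x h1 hx
    have hx' : 0 < x.2 := hx
    have hP := Pot_nonneg hpos x
    rcases (hpos x hx).eq_or_lt with h0 | h0
    · rw [← h0]; positivity
    · have h2 := h1 h0
      have h3 : 0 ≤ c * min 1 x.2 := by positivity
      have h4 : (1 / lam) * ω x ≤ Pot ω x := by linarith [Gop_le_Pot hv hpos x]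
      rw [one_div_mul_eq_div, div_le_iff₀ hlam0] at h4
      linarith
  obtain ⟨hFi, hFt⟩ := HPot_tendsto hv hpos
  set F : ℝ × ℝ → ℝ := fun x => ∫ z, HK z * Pot ω (x - z) with hF
  have hGF : ∀ x ∈ UHP, Gop ω x ≤ x.2 * (lam * F x) := by
    intro x hx
    have hx' : 0 < x.2 := hx
    have e : F x = ∫ y, HK (x - y) * Pot ω y := by
      have := integral_sub_left_eq_self (fun z => HK z * Pot ω (x - z)) volume x
      rw [hF]
      simp only [sub_sub_cancel] at this
      exact this.symm
    have hi : Integrable (fun y => HK (x - y) * Pot ω y) := by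
      have := (hFi x).comp_sub_left x
      simpa only [sub_sub_cancel] using this
    have hi2 := (hi.const_mul (x.2 * lam))
    calc Gop ω x ≤ ∫ y in UHP, (x.2 * lam) * (HK (x - y) * Pot ω y) := by
          refine integral_mono_ae (slice_integrable hv x) hi2.integrableOn ?_
          filter_upwards [ae_good x, hle] with y hy h2
          calc GUHP x y * ω y ≤ (x.2 * HK (x - y)) * (lam * Pot ω y) :=
                mul_le_mul (GUHP_le_HK hx hy.1 hy.2) h2 (hpos y hy.1)
                  (mul_nonneg hx'.le (HK_nonneg _))
            _ = _ := by ring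
      _ ≤ ∫ y, (x.2 * lam) * (HK (x - y) * Pot ω y) :=
          setIntegral_le_integral hi2 (Eventually.of_forall fun y =>
            mul_nonneg (by positivity) (mul_nonneg (HK_nonneg _) (Pot_nonneg hpos _)))
      _ = x.2 * (lam * F x) := by rw [integral_const_mul, e]; ring
  have hev : ∀ᶠ x in cocompact (ℝ × ℝ), Pot ω x < c ∧ lam * F x < c := by
    have h2 : Tendsto (fun x => lam * F x) (cocompact (ℝ × ℝ)) (nhds 0) := by
      simpa using hFt.const_mul lam
    exact ((Pot_tendsto hv hpos).eventually_lt_const hc).and (h2.eventually_lt_const hc)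
  rw [← Metric.cobounded_eq_cocompact] at hev
  obtain ⟨R, -, hR⟩ := (Filter.hasBasis_cobounded_norm (E := ℝ × ℝ)).eventually_iff.1 hev
  refine ⟨2 * |R| + 1, by positivity, ?_⟩
  filter_upwards [hEL, ae_restrict_mem UHP_meas] with x h1 hx hr
  have hx' : 0 < x.2 := hx
  have hn : R ≤ ‖x‖ := by
    have := rad_le_norm x
    have := le_abs_self R
    linarith
  obtain ⟨k1, k2⟩ := hR hn
  by_contra hne
  have h0 : 0 < ω x := lt_of_le_of_ne (hpos x hx) (Ne.symm hne)
  have h2 := h1 h0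
  have h3 : 0 < (1 / lam) * ω x := by positivity
  rcases le_total 1 x.2 with h | h
  · rw [min_eq_left h] at h2
    linarith [Gop_le_Pot hv hpos x]
  · rw [min_eq_right h] at h2
    have := hGF x hx
    nlinarith


/-- maximizers have compact support in the closure of `Π`. -/
theorem stmt11 (lam μ ν : ℝ) (hlam : 1 < lam) (hμ : 0 < μ) (hν : 0 < ν)
    (h : μ * varrho lam ≤ ν) (ω : ℝ × ℝ → ℝ) (hω : IsMaximizer lam μ ν ω) :
    ∃ R : ℝ, 0 < R ∧ ∀ᵐ x ∂(volume.restrict UHP), R ≤ rad x → ω x = 0 := by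
  exact compact_support hlam hμ hν hω
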